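/- arXiv:2011.05575 — 2 statements merged into one kernel-verified Lean document; each statement's English description precedes it below -/
import Mathlib

section
/- A strongly connected directed graph with constant outdegree of all its vertices admits a synchronizing coloring (i.e., a labelling of edges by colors turning it into a deterministic finite automaton possessing a synchronizing word) if and only if the greatest common divisor of the lengths of all its cycles is 1. -/
/-- Run a word through a DFA with transition function `δ`. -/
def runWord {Q A : Type*} (δ : Q → A → Q) (q : Q) (w : List A) : Q := w.foldl δ q

/-- A closed directed walk of positive length `n` based at `v` in the digraph `R`. -/
def IsClosedWalk {V : Type*} (R : V → V → Prop) (v : V) (n : ℕ) : Prop :=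
  0 < n ∧ ∃ g : ℕ → V, g 0 = v ∧ g n = v ∧ ∀ i < n, R (g i) (g (i + 1))

open Function

namespace RoadColoring

section FunctionalGraph

variable {V : Type*}

theorem iterate_mem_periodicPts {g : V → V} {x : V} (hx : x ∈ periodicPts g) (k : ℕ) :
    g^[k] x ∈ periodicPts g := by
  obtain ⟨n, hn, h⟩ := hx
  exact mk_mem_periodicPts hn (h.apply_iterate k)

theorem exists_iterate_mem_periodicPts [Finite V] (g : V → V) (v : V) :
    ∃ k, g^[k] v ∈ periodicPts g := by
  obtain ⟨i, j, hij, h⟩ := Finite.exists_ne_map_eq_of_infinite (fun n => g^[n] v)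
  wlog hlt : i < j generalizing i j
  · exact this j i hij.symm h.symm (by omega)
  refine ⟨i, mk_mem_periodicPts (n := j - i) (by omega) ?_⟩
  rw [IsPeriodicPt, IsFixedPt, ← iterate_add_apply, Nat.sub_add_cancel hlt.le]
  exact h.symm

/-- The number of steps from `v` to the cycle it eventually reaches under `g`. -/
noncomputable def height (g : V → V) (v : V) : ℕ := sInf {k | g^[k] v ∈ periodicPts g}

/-- The first point of the orbit of `v` that lies on a cycle of `g`. -/
noncomputable def root (g : V → V) (v : V) : V := g^[height g v] v

theorem root_mem [Finite V] (g : V → V) (v : V) : root g v ∈ periodicPts g :=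
  Nat.sInf_mem (s := {k | g^[k] v ∈ periodicPts g}) (exists_iterate_mem_periodicPts g v)

theorem iterate_notMem {g : V → V} {v : V} {k : ℕ} (hk : k < height g v) :
    g^[k] v ∉ periodicPts g :=
  Nat.notMem_of_lt_sInf (s := {k | g^[k] v ∈ periodicPts g}) hk

theorem height_le {g : V → V} {v : V} {k : ℕ} (hk : g^[k] v ∈ periodicPts g) :
    height g v ≤ k :=
  Nat.sInf_le (s := {k | g^[k] v ∈ periodicPts g}) hk

theorem iterate_mem_of_height_le [Finite V] {g : V → V} {v : V} {k : ℕ} (hk : height g v ≤ k) :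
    g^[k] v ∈ periodicPts g := by
  obtain ⟨j, rfl⟩ := Nat.exists_eq_add_of_le' hk
  rw [iterate_add_apply]
  exact iterate_mem_periodicPts (root_mem g v) j

theorem height_eq [Finite V] {g : V → V} {v : V} {k : ℕ} (hk : g^[k] v ∈ periodicPts g)
    (h : ∀ i < k, g^[i] v ∉ periodicPts g) : height g v = k := by
  refine (height_le hk).antisymm (not_lt.1 fun hlt => h _ hlt (root_mem g v))

theorem height_pos [Finite V] {g : V → V} {v : V} : 0 < height g v ↔ v ∉ periodicPts g := by
  refine ⟨fun h => iterate_notMem h, fun h => Nat.pos_of_ne_zero fun h0 => h ?_⟩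
  simpa [root, h0] using root_mem g v

theorem height_eq_add [Finite V] {g : V → V} {v b : V} {k : ℕ} (hk : g^[k] v = b)
    (hb : b ∉ periodicPts g) : height g v = height g b + k := by
  subst hk
  refine height_eq ?_ fun i hi hmem => ?_
  · rw [iterate_add_apply]
    exact root_mem g _
  · rcases lt_or_ge i k with h | h
    · obtain ⟨j, rfl⟩ := Nat.exists_eq_add_of_le' h.le
      exact hb (by rw [iterate_add_apply]; exact iterate_mem_periodicPts hmem j)
    · obtain ⟨j, rfl⟩ := Nat.exists_eq_add_of_le' h
      rw [iterate_add_apply] at hmem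
      exact iterate_notMem (by omega) hmem

theorem root_eq_of_notMem [Finite V] {g : V → V} {v b : V} {k : ℕ} (hk : g^[k] v = b)
    (hb : b ∉ periodicPts g) : root g v = root g b := by
  rw [root, height_eq_add hk hb, iterate_add_apply, hk, root]

theorem root_iterate [Finite V] {g : V → V} {v : V} {k : ℕ} (hk : k ≤ height g v) :
    root g (g^[k] v) = root g v := by
  obtain ⟨j, hj⟩ := Nat.exists_eq_add_of_le' hk
  have : height g (g^[k] v) = j := by
    refine height_eq ?_ fun i hi => ?_
    · rw [← iterate_add_apply, ← hj]
      exact root_mem g v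
    · rw [← iterate_add_apply]
      exact iterate_notMem (by omega)
  rw [root, root, this, ← iterate_add_apply, hj]

theorem mem_periodicPts_congr {g h : V → V} {u : V} (H : ∀ n, h^[n] u = g^[n] u) :
    u ∈ periodicPts h ↔ u ∈ periodicPts g := by
  simp only [mem_periodicPts, IsPeriodicPt, IsFixedPt, H]

theorem iterate_mem_periodicPts_congr {g h : V → V} {u : V} (H : ∀ n, h^[n] u = g^[n] u) (k : ℕ) :
    h^[k] u ∈ periodicPts h ↔ g^[k] u ∈ periodicPts g := by
  rw [H k]
  apply mem_periodicPts_congr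
  intro n
  rw [← H k, ← iterate_add_apply, H, H k, ← iterate_add_apply]

theorem height_congr {g h : V → V} {u : V} (H : ∀ n, h^[n] u = g^[n] u) :
    height h u = height g u := by
  simp only [height, iterate_mem_periodicPts_congr H]

theorem exists_iterate_eq_of_mem_periodicPts {g : V → V} {x y : V} {s : ℕ}
    (hx : x ∈ periodicPts g) (h : g^[s] x = y) : ∃ t, g^[t] y = x := by
  obtain ⟨n, hn, hp⟩ := hx
  obtain ⟨t, ht⟩ := Nat.exists_eq_add_of_le' (Nat.le_mul_of_pos_left s hn)
  exact ⟨t, by rw [← h, ← iterate_add_apply, ← ht]; exact hp.mul_const s⟩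

variable [DecidableEq V]

theorem update_iterate {g : V → V} {b x u : V} {n : ℕ} (h : ∀ i < n, g^[i] u ≠ b) :
    (update g b x)^[n] u = g^[n] u := by
  induction n with
  | zero => rfl
  | succ n ih =>
    rw [iterate_succ_apply', iterate_succ_apply', ih fun i hi => h i (by omega),
      update_of_ne (h n (by omega))]

theorem update_iterate_of_mem_periodicPts {g : V → V} {b x u : V} (hu : u ∈ periodicPts g)
    (hb : b ∉ periodicPts g) (n : ℕ) : (update g b x)^[n] u = g^[n] u :=
  update_iterate fun i _ h => hb (h ▸ iterate_mem_periodicPts hu i)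

/-- If the orbit of `x` avoids `b`, redirecting `b` to `x` makes `b` non-periodic. -/
theorem notMem_periodicPts_update {g : V → V} {b x : V} (h : ∀ k, g^[k] x ≠ b) :
    b ∉ periodicPts (update g b x) := by
  rintro ⟨n, hn, hb⟩
  obtain ⟨m, rfl⟩ := Nat.exists_eq_succ_of_ne_zero hn.ne'
  rw [IsPeriodicPt, IsFixedPt, iterate_succ_apply, update_self,
    update_iterate fun i _ => h i] at hb
  exact h m hb

theorem height_update_self [Finite V] {g : V → V} {b x : V} (h : ∀ k, g^[k] x ≠ b) :
    height (update g b x) b = height g x + 1 := by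
  have hb := notMem_periodicPts_update h
  have H : ∀ n, (update g b x)^[n] x = g^[n] x := fun n => update_iterate fun i _ => h i
  have h0 := height_pos.2 hb
  have : height (update g b x) (update g b x b) + 1 = height (update g b x) b := by
    have := @height_eq _ _ (update g b x) (update g b x b) (height (update g b x) b - 1) ?_ ?_
    · omega
    · rw [← iterate_succ_apply, Nat.succ_eq_add_one, Nat.sub_add_cancel h0]
      exact root_mem _ _
    · intro i hi
      rw [← iterate_succ_apply]
      exact iterate_notMem (by omega)
  rw [← this, update_self, height_congr H]

theorem root_update_self [Finite V] {g : V → V} {b x : V} (h : ∀ k, g^[k] x ≠ b) :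
    root (update g b x) b = root g x := by
  have H : ∀ n, (update g b x)^[n] x = g^[n] x := fun n => update_iterate fun i _ => h i
  rw [root, height_update_self h, iterate_succ_apply, update_self, H, root]

theorem exists_first_hit {g : V → V} {v b : V} (h : ∃ k, g^[k] v = b) :
    ∃ k, (∀ i < k, g^[i] v ≠ b) ∧ g^[k] v = b := by
  classical
  exact ⟨Nat.find h, fun i hi => Nat.find_min h hi, Nat.find_spec h⟩

/-- Beyond some height, all vertices of the functional graph of `g` hang from the same root. -/
def HasDominantTree (g : V → V) : Prop :=
  ∃ n r, (∃ v, n < height g v) ∧ ∀ v, n < height g v → root g v = r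

/-- `g` selects an outgoing edge at every vertex, with as many periodic points as possible. -/
structure IsMaxCyclic (E : V → V → Prop) (g : V → V) : Prop where
  edge : ∀ v, E v (g v)
  ncard_le : ∀ h : V → V, (∀ v, E v (h v)) → (periodicPts h).ncard ≤ (periodicPts g).ncard

theorem update_edge {E : V → V → Prop} {g : V → V} {b x : V} (hg : ∀ v, E v (g v))
    (hx : E b x) (v : V) :
    E v (update g b x v) := by
  by_cases h : v = b
  · subst h; simpa
  · simpa [h] using hg v

variable [Finite V] {E : V → V → Prop} {g : V → V}

theorem hasDominantTree_update {L : ℕ} {b x u : V} (hL : ∀ v, height g v ≤ L)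
    (hx : ∀ k, g^[k] x ≠ b) (hu : L < height (update g b x) u) :
    HasDominantTree (update g b x) := by
  refine ⟨L, root (update g b x) b, ⟨u, hu⟩, fun v hv => ?_⟩
  by_cases hvb : ∃ k, g^[k] v = b
  · obtain ⟨k, hk, hkb⟩ := exists_first_hit hvb
    exact root_eq_of_notMem ((update_iterate hk).trans hkb) (notMem_periodicPts_update hx)
  · push Not at hvb
    rw [height_congr fun n => update_iterate fun i _ => hvb i] at hv
    exact absurd (hL v) (by omega)

theorem IsMaxCyclic.iterate_ne {b x : V} (hg : IsMaxCyclic E g) (hx : E b x)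
    (hb : b ∉ periodicPts g) (k : ℕ) : g^[k] x ≠ b := by
  intro hk
  obtain ⟨k, hk, hkb⟩ := exists_first_hit ⟨k, hk⟩
  have hper : b ∈ periodicPts (update g b x) := by
    refine mk_mem_periodicPts (Nat.succ_pos k) ?_
    rw [IsPeriodicPt, IsFixedPt, iterate_succ_apply, update_self, update_iterate hk, hkb]
  refine (hg.ncard_le _ (update_edge hg.edge hx)).not_gt
    (Set.ncard_lt_ncard ⟨fun u hu => ?_, fun h => hb (h hper)⟩ (Set.toFinite _))
  exact (mem_periodicPts_congr (update_iterate_of_mem_periodicPts hu hb)).2 hu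

/-- Redirecting a periodic vertex `b` on the cycle below a highest vertex `p` to `p` either creates
a dominant tree or merely exchanges the roles of `p` and `g b`. -/
theorem IsMaxCyclic.update_cycle {L : ℕ} {b p : V} (hg : IsMaxCyclic E g)
    (hL : ∀ v, height g v ≤ L) (hp : height g p = L) (hpos : 0 < L) (hbp : E b p)
    (hb : b ∈ periodicPts g) (hk : ∃ k, g^[k] p = b) :
    HasDominantTree (update g b p) ∨
      IsMaxCyclic E (update g b p) ∧ (∀ v, height (update g b p) v ≤ L) ∧
        height (update g b p) (g b) = L ∧ root (update g b p) (g b) = root g p ∧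
        ∀ i ≤ L, (update g b p)^[i] (g b) = g^[i] (g b) := by
  obtain ⟨k, hkmin, hkb⟩ := exists_first_hit hk
  set h := update g b p with hh
  set c := g b with hc
  set d := height h c with hd
  have hcb : g^[1] b = c := rfl
  have hit : ∀ i ≤ k, h^[i] p = g^[i] p := fun i hi =>
    update_iterate fun j hj => hkmin j (by omega)
  have hper : IsPeriodicPt h (k + 1) p := by
    rw [IsPeriodicPt, IsFixedPt, iterate_succ_apply', hit k le_rfl, hkb, hh, update_self]
  have pper : p ∈ periodicPts h := mk_mem_periodicPts k.succ_pos hper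
  have iper : ∀ i ≤ k, g^[i] p ∈ periodicPts h := fun i hi =>
    hit i hi ▸ iterate_mem_periodicPts pper i
  have bper : b ∈ periodicPts h := hkb ▸ iper k le_rfl
  have notper : ∀ i < L, g^[i] p ∉ periodicPts g := fun i hi => iterate_notMem (hp ▸ hi)
  have hLk : L ≤ k := not_lt.1 fun hlt => notper k hlt (hkb ▸ hb)
  have cper : c ∈ periodicPts g := iterate_mem_periodicPts hb 1
  have cne : ∀ i < d, g^[i] c ≠ b := by
    intro i
    induction i using Nat.strong_induction_on with
    | _ i ih =>
      intro hi hib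
      have : h^[i] c = b := (update_iterate fun j hj => ih j hj (by omega)).trans hib
      exact iterate_notMem hi (this ▸ bper)
  have cit : ∀ i ≤ d, h^[i] c = g^[i] c := fun i hi =>
    update_iterate fun j hj => cne j (by omega)
  have hroot : root h c = root g p := by
    obtain ⟨n, hn⟩ : ∃ n, g^[n] c = b := exists_iterate_eq_of_mem_periodicPts hb hcb
    obtain ⟨n, hnmin, hnb⟩ := exists_first_hit ⟨n, hn⟩
    have hhn : h^[n] c = b := (update_iterate hnmin).trans hnb
    have hdn : d ≤ n := height_le (hhn ▸ bper)
    have hto : h^[n - d + 1] (root h c) = p := by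
      rw [root, ← iterate_add_apply, show n - d + 1 + d = n + 1 by omega, iterate_succ_apply', hhn,
        hh, update_self]
    obtain ⟨t, ht⟩ := exists_iterate_eq_of_mem_periodicPts (root_mem h c) hto
    rw [← hper.iterate_mod_apply] at ht
    have hj : t % (k + 1) ≤ k := Nat.le_of_lt_succ (Nat.mod_lt _ k.succ_pos)
    generalize t % (k + 1) = j at ht hj
    rw [hit j hj] at ht
    have hrd : root h c = g^[d] c := cit d le_rfl
    have hLj : L ≤ j := not_lt.1 fun hlt => notper j hlt
      (by rw [ht, hrd]; exact iterate_mem_periodicPts cper d)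
    rcases hLj.eq_or_lt with rfl | hlt
    · rw [← ht, root, hp]
    exfalso
    obtain ⟨j, rfl⟩ := Nat.exists_eq_succ_of_ne_zero (by omega : j ≠ 0)
    have hjper : g^[j] p ∈ periodicPts g :=
      iterate_mem_of_height_le (by omega)
    rw [hrd, iterate_succ_apply'] at ht
    have inj := (bijOn_periodicPts g).injOn
    rcases hd0 : d with _ | d'
    · rw [hd0] at ht
      exact hkmin j (by omega) (inj hjper hb ht)
    · rw [hd0, iterate_succ_apply'] at ht
      have := inj hjper (iterate_mem_periodicPts cper d') ht
      refine iterate_notMem (g := h) (v := c) (k := d') (by omega) ?_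
      rw [cit d' (by omega), ← this]
      exact iper j (by omega)
  have cover : ∀ x ∈ periodicPts g, x ∈ periodicPts h ∨ ∃ i < d, g^[i] c = x := by
    intro x hx
    by_cases hxb : ∃ s, g^[s] x = b
    · obtain ⟨s, hs⟩ := hxb
      have hs' : g^[s + 1] x = c := by rw [iterate_succ_apply', hs]
      obtain ⟨i, himin, hi⟩ := exists_first_hit (exists_iterate_eq_of_mem_periodicPts hx hs')
      rcases lt_or_ge i d with hid | hid
      · exact Or.inr ⟨i, hid, hi⟩
      · left
        have : h^[i] c = x := by
          refine (update_iterate fun j hj hjb => himin (i - (j + 1)) (by omega) ?_).trans hi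
          have hjc : g^[j + 1] c = c := by rw [iterate_succ_apply', hjb]
          rw [← hi]
          conv_rhs => rw [← Nat.sub_add_cancel hj, iterate_add_apply, hjc]
        exact this ▸ iterate_mem_of_height_le hid
    · push Not at hxb
      exact Or.inl ((mem_periodicPts_congr fun n => update_iterate fun i _ => hxb i).2 hx)
  have hcard : (periodicPts g).ncard + L ≤ (periodicPts h).ncard + d := by
    set A := (fun i => g^[i] p) '' Set.Iio L
    set D := (fun i => g^[i] c) '' Set.Iio d
    have hA : A.ncard = L := by
      have hne : ∀ i j, i < j → j < L → g^[i] p ≠ g^[j] p := by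
        intro i j hlt hj hij
        refine notper (L - j + i) (by omega) ?_
        rw [iterate_add_apply, hij, ← iterate_add_apply]
        exact iterate_mem_of_height_le (by omega)
      rw [Set.InjOn.ncard_image]
      · simp
      · intro i hi j hj hij
        rcases lt_trichotomy i j with h | h | h
        · exact absurd hij (hne i j h hj)
        · exact h
        · exact absurd hij.symm (hne j i h hi)
    have hD : D.ncard ≤ d := by
      simpa using Set.ncard_image_le (f := fun i => g^[i] c) (Set.finite_Iio d)
    have hdisj : Disjoint (periodicPts g) A := by
      rw [Set.disjoint_left]
      rintro _ hx ⟨i, hi, rfl⟩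
      exact notper i hi hx
    have hsub : periodicPts g ∪ A ⊆ periodicPts h ∪ D := by
      rintro x (hx | ⟨i, hi, rfl⟩)
      · exact (cover x hx).imp id fun ⟨i, hi, h⟩ => ⟨i, hi, h⟩
      · exact Or.inl (iper i (le_trans (le_of_lt hi) hLk))
    have h1 := Set.ncard_le_ncard hsub (Set.toFinite _)
    have h2 := Set.ncard_union_le (periodicPts h) D
    rw [Set.ncard_union_eq hdisj (Set.toFinite _) (Set.toFinite _)] at h1
    omega
  have hle := hg.ncard_le h (update_edge hg.edge hbp)
  have key : ∀ v, L < height h v → root h v = root g p := by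
    intro v hv
    have hx : h^[height g v] v = root g v := update_iterate fun i hi hib =>
      iterate_notMem hi (hib ▸ hb)
    have hvL := hL v
    rcases cover _ (root_mem g v) with hm | ⟨i, hi, hic⟩
    · exact absurd (height_le (hx ▸ hm)) (by omega)
    · rw [← root_iterate (g := h) (k := height g v) (by omega), hx, ← hic, ← cit i hi.le,
        root_iterate hi.le, hroot]
  by_cases hall : ∀ v, height h v ≤ L
  · have hdL : d = L := le_antisymm (hall c) (by omega)
    refine Or.inr ⟨⟨update_edge hg.edge hbp, fun g' hg' => ?_⟩, hall, hdL, hroot,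
      fun i hi => cit i (hdL ▸ hi)⟩
    exact (hg.ncard_le g' hg').trans (by omega)
  · push Not at hall
    exact Or.inl ⟨L, root g p, hall, key⟩

theorem hasDominantTree_update_of_injective {p s : V} (hg : Injective g) (hs : s ≠ g p) :
    HasDominantTree (update g p s) := by
  set h := update g p s with hh
  refine ⟨0, s, ?_, fun v hv => ?_⟩
  · simp only [height_pos]
    by_contra! hall
    obtain ⟨w, rfl⟩ := (Finite.injective_iff_surjective.1 hg) s
    have hw : w ≠ p := fun e => hs (e ▸ rfl)
    refine hw ((bijOn_periodicPts h).injOn (hall w) (hall p) ?_)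
    rw [hh, update_self, update_of_ne hw]
  · obtain ⟨n, hn⟩ := Nat.exists_eq_succ_of_ne_zero hv.ne'
    have hu : h^[n] v ∉ periodicPts h := iterate_notMem (by omega)
    have hur : h (h^[n] v) = root h v := by rw [root, hn, iterate_succ_apply']
    obtain ⟨w, hw, hwr⟩ := (bijOn_periodicPts h).surjOn (root_mem h v)
    by_cases hup : h^[n] v = p
    · rw [← hur, hup, hh, update_self]
    by_cases hwp : w = p
    · rw [← hwr, hwp, hh, update_self]
    refine absurd (hg (a₁ := h^[n] v) (a₂ := w) ?_) fun e => hu (e ▸ hw)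
    rw [← hwr, hh, update_of_ne hup, update_of_ne hwp] at hur
    exact hur

theorem IsMaxCyclic.hasDominantTree_or_update {L : ℕ} {b p : V} (hg : IsMaxCyclic E g)
    (hL : ∀ v, height g v ≤ L) (hp : height g p = L) (hpos : 0 < L) (hbp : E b p) :
    (∃ h, (∀ v, E v (h v)) ∧ HasDominantTree h) ∨
      b ∈ periodicPts g ∧ g^[L] (g b) = g^[L] p ∧
        IsMaxCyclic E (update g b p) ∧ (∀ v, height (update g b p) v ≤ L) ∧
        height (update g b p) (g b) = L ∧
        ∀ i ≤ L, (update g b p)^[i] (g b) = g^[i] (g b) := by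
  by_cases hk : ∃ k, g^[k] p = b
  · have hb : b ∈ periodicPts g := by
      by_contra hb
      exact hk.elim (hg.iterate_ne hbp hb)
    rcases hg.update_cycle hL hp hpos hbp hb hk with h | ⟨h1, h2, h3, h4, h5⟩
    · exact Or.inl ⟨_, update_edge hg.edge hbp, h⟩
    · refine Or.inr ⟨hb, ?_, h1, h2, h3, h5⟩
      rwa [root, root, h3, hp, h5 L le_rfl] at h4
  · push Not at hk
    refine Or.inl ⟨_, update_edge hg.edge hbp, hasDominantTree_update hL hk (u := b) ?_⟩
    rw [height_update_self hk]
    omega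

/-- If the last vertex before the root on the path from a highest vertex has a second successor,
then some selection of edges has a dominant tree. -/
theorem IsMaxCyclic.exists_hasDominantTree_of_edge {L : ℕ} {b p s : V} (hg : IsMaxCyclic E g)
    (hL : ∀ v, height g v ≤ L) (hp : height g p = L) (hpos : 0 < L) (hbp : E b p)
    (hs : E (g^[L - 1] p) s) (hne : s ≠ g^[L] p) :
    ∃ h, (∀ v, E v (h v)) ∧ HasDominantTree h := by
  rcases hg.hasDominantTree_or_update hL hp hpos hbp with h | ⟨hb, hbL, -⟩
  · exact h
  set y := g^[L - 1] p with hy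
  have hyper : y ∉ periodicPts g := iterate_notMem (by omega)
  have avoid : ∀ k, g^[k] s ≠ y := hg.iterate_ne hs hyper
  have hyone : height g y = 1 := by
    have := height_eq_add hy.symm hyper
    omega
  set h := update g y s with hh
  have hedge : ∀ v, E v (h v) := update_edge hg.edge hs
  have hper : ∀ u ∈ periodicPts g, ∀ n, h^[n] u = g^[n] u := fun u hu =>
    update_iterate_of_mem_periodicPts hu hyper
  have hyper' : y ∉ periodicPts h := notMem_periodicPts_update avoid
  have hheight : ∀ v k, g^[k] v = y → height h v = height g v + height g s := by
    intro v k hk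
    obtain ⟨k, hk, hky⟩ := exists_first_hit ⟨k, hk⟩
    rw [height_eq_add hky hyper, height_eq_add ((update_iterate hk).trans hky) hyper',
      height_update_self avoid, hyone]
    omega
  rcases Nat.eq_zero_or_pos (height g s) with h0 | h0
  · have hmax : IsMaxCyclic E h := by
      refine ⟨hedge, fun g' hg' => (hg.ncard_le g' hg').trans
        (Set.ncard_le_ncard (fun u hu => ?_) (Set.toFinite _))⟩
      exact (mem_periodicPts_congr (hper u hu)).2 hu
    have hL' : ∀ v, height h v ≤ L := by
      intro v
      by_cases hv : ∃ k, g^[k] v = y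
      · obtain ⟨k, hk⟩ := hv
        rw [hheight v k hk, h0]
        exact hL v
      · push Not at hv
        rw [height_congr fun n => update_iterate fun i _ => hv i]
        exact hL v
    have hp' : height h p = L := by rw [hheight p _ hy.symm, hp, h0, add_zero]
    rcases hmax.hasDominantTree_or_update hL' hp' hpos hbp with h | ⟨-, hbL', -⟩
    · exact h
    have hrp : h^[L] p = s := by
      obtain ⟨k, hk, hky⟩ := exists_first_hit ⟨_, hy.symm⟩
      have : h^[L] p = root h p := by rw [root, hp']
      rw [this, root_eq_of_notMem ((update_iterate hk).trans hky) hyper', root_update_self avoid,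
        root, h0, iterate_zero_apply]
    rw [hrp, ← iterate_succ_apply, hper b hb, iterate_succ_apply, hbL] at hbL'
    exact absurd hbL'.symm hne
  · exact ⟨h, hedge, hasDominantTree_update hL avoid (u := p)
      (by rw [hheight p _ hy.symm]; omega)⟩

theorem exists_hasDominantTree (hE : ∀ v, ∃ w, E v w) (hpred : ∀ p, ∃ b, E b p)
    (hbunch : ∀ y z r, (∀ w, E y w → w = r) → (∀ w, E z w → w = r) → y = z)
    (hbranch : ∃ p s t, E p s ∧ E p t ∧ s ≠ t) :
    ∃ h, (∀ v, E v (h v)) ∧ HasDominantTree h := by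
  obtain ⟨g, hg⟩ : ∃ g, IsMaxCyclic E g := by
    choose g₀ hg₀ using hE
    have : Nonempty {g : V → V // ∀ v, E v (g v)} := ⟨g₀, hg₀⟩
    obtain ⟨g, hg⟩ := Finite.exists_max
      fun g : {g : V → V // ∀ v, E v (g v)} => (periodicPts g.1).ncard
    exact ⟨g, g.2, fun h hh => hg ⟨h, hh⟩⟩
  obtain ⟨q, s, t, hs, ht, hst⟩ := hbranch
  have : Nonempty V := ⟨q⟩
  obtain ⟨p, hp⟩ := Finite.exists_max (height g)
  rcases Nat.eq_zero_or_pos (height g p) with h0 | hpos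
  · have hinj : Injective g := injective_iff_periodicPts_eq_univ.2 <| Set.eq_univ_of_forall
      fun v => by
        by_contra hv
        have := height_pos.2 hv
        have := hp v
        omega
    obtain ⟨r, hr, hne⟩ : ∃ r, E q r ∧ r ≠ g q := by
      by_cases h : s = g q
      · exact ⟨t, ht, fun e => hst (h.trans e.symm)⟩
      · exact ⟨s, hs, h⟩
    exact ⟨_, update_edge hg.edge hr, hasDominantTree_update_of_injective hinj hne⟩
  · obtain ⟨b, hb⟩ := hpred p
    rcases hg.hasDominantTree_or_update hp rfl hpos hb with h | ⟨hbper, hr, hmax, hL, hc, hit⟩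
    · exact h
    set L := height g p with hLdef
    by_cases hy : ∃ s, E (g^[L - 1] p) s ∧ s ≠ g^[L] p
    · obtain ⟨s, hs, hne⟩ := hy
      exact hg.exists_hasDominantTree_of_edge hp rfl hpos hb hs hne
    by_cases hz : ∃ s, E (g^[L - 1] (g b)) s ∧ s ≠ g^[L] (g b)
    · obtain ⟨s, hs, hne⟩ := hz
      exact hmax.exists_hasDominantTree_of_edge hL hc hpos (hg.edge b)
        (by rwa [hit _ (Nat.sub_le _ _)]) (by rwa [hit _ le_rfl])
    push Not at hy hz
    rw [hr] at hz
    refine absurd (hbunch _ _ _ hy hz) fun e => ?_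
    refine iterate_notMem (g := g) (v := p) (k := L - 1) (by omega) (e ▸ ?_)
    exact iterate_mem_periodicPts (iterate_mem_periodicPts hbper 1) _

end FunctionalGraph

section Automaton

variable {Q A : Type*} {δ : Q → A → Q}

theorem runWord_append (q : Q) (u v : List A) :
    runWord δ q (u ++ v) = runWord δ (runWord δ q u) v :=
  List.foldl_append

theorem runWord_cons (q : Q) (a : A) (v : List A) :
    runWord δ q (a :: v) = runWord δ (δ q a) v :=
  rfl

theorem runWord_replicate {g : Q → Q} {a : A} (h : ∀ q, δ q a = g q) (n : ℕ) (q : Q) :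
    runWord δ q (List.replicate n a) = g^[n] q := by
  induction n generalizing q with
  | zero => rfl
  | succ n ih => rw [List.replicate_succ, runWord_cons, ih, h, iterate_succ_apply]

theorem exists_runWord_eq {p q : Q}
    (h : Relation.ReflTransGen (fun x y => ∃ a, δ x a = y) p q) : ∃ w, runWord δ p w = q := by
  induction h using Relation.ReflTransGen.head_induction_on with
  | refl => exact ⟨[], rfl⟩
  | head h _ ih =>
    obtain ⟨a, rfl⟩ := h
    obtain ⟨w, hw⟩ := ih
    exact ⟨a :: w, hw⟩

/-- Two states are stable if, wherever a word takes them, they can still be merged. -/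
def Stable (δ : Q → A → Q) (p q : Q) : Prop :=
  ∀ u, ∃ v, runWord δ (runWord δ p u) v = runWord δ (runWord δ q u) v

/-- The equivalence relation of stability. -/
def stableSetoid (δ : Q → A → Q) : Setoid Q where
  r := Stable δ
  iseqv :=
    { refl := fun _ _ => ⟨[], rfl⟩
      symm := fun h u => (h u).imp fun _ => Eq.symm
      trans := fun {p q r} hpq hqr u => by
        obtain ⟨v, hv⟩ := hpq u
        obtain ⟨w, hw⟩ := hqr (u ++ v)
        refine ⟨v ++ w, ?_⟩
        simp only [runWord_append] at hw ⊢
        rw [hv, hw] }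

theorem Stable.step {p q : Q} (h : Stable δ p q) (a : A) : Stable δ (δ p a) (δ q a) :=
  fun u => h (a :: u)

theorem stable_of_forall_step_eq {p q : Q} [Nonempty A] (h : ∀ a, δ p a = δ q a) :
    Stable δ p q := by
  rintro (_ | ⟨a, u⟩)
  · exact ⟨[Classical.arbitrary A], h _⟩
  · exact ⟨[], by rw [runWord_cons, runWord_cons, h]⟩

/-- The automaton induced on the classes of stable states. -/
def quotientStep (δ : Q → A → Q) (X : Quotient (stableSetoid δ)) (a : A) :
    Quotient (stableSetoid δ) :=
  Quotient.map (fun q => δ q a) (fun _ _ h => Stable.step h a) X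

/-- Permute the colors of `δ` in the same way on each class of stable states. -/
def recolor (δ : Q → A → Q) (σ : Quotient (stableSetoid δ) → Equiv.Perm A) (q : Q) (a : A) : Q :=
  δ q (σ (Quotient.mk _ q) a)

theorem mk_runWord_recolor (σ : Quotient (stableSetoid δ) → Equiv.Perm A) (q : Q) (w : List A) :
    Quotient.mk (stableSetoid δ) (runWord (recolor δ σ) q w) =
      runWord (fun X a => quotientStep δ X (σ X a)) (Quotient.mk _ q) w := by
  induction w generalizing q with
  | nil => rfl
  | cons a w ih => exact ih _

theorem exists_runWord_recolor_eq (σ : Quotient (stableSetoid δ) → Equiv.Perm A)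
    (X : Quotient (stableSetoid δ)) (v : List A) :
    ∃ u, ∀ q, Quotient.mk _ q = X → runWord (recolor δ σ) q u = runWord δ q v := by
  induction v generalizing X with
  | nil => exact ⟨[], fun _ _ => rfl⟩
  | cons a v ih =>
    obtain ⟨u, hu⟩ := ih (quotientStep δ X a)
    refine ⟨(σ X).symm a :: u, ?_⟩
    rintro q rfl
    simp only [runWord_cons, recolor, Equiv.apply_symm_apply]
    exact hu _ rfl

theorem exists_merge_recolor {σ : Quotient (stableSetoid δ) → Equiv.Perm A} {w : List A}
    {X : Quotient (stableSetoid δ)}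
    (hw : ∀ Y, runWord (fun X a => quotientStep δ X (σ X a)) Y w = X) (p q : Q) :
    ∃ u, runWord (recolor δ σ) p u = runWord (recolor δ σ) q u := by
  have hX : ∀ r, Quotient.mk _ (runWord (recolor δ σ) r w) = X := fun r =>
    (mk_runWord_recolor σ r w).trans (hw _)
  have hst : Stable δ (runWord (recolor δ σ) p w) (runWord (recolor δ σ) q w) :=
    Quotient.exact ((hX p).trans (hX q).symm)
  obtain ⟨v, hv⟩ := hst []
  obtain ⟨u, hu⟩ := exists_runWord_recolor_eq σ X v
  refine ⟨w ++ u, ?_⟩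
  rw [runWord_append, runWord_append, hu _ (hX p), hu _ (hX q)]
  exact hv

variable [Fintype Q] [DecidableEq Q]

/-- The set of states reached by the word `w`. -/
def wordImage (δ : Q → A → Q) (w : List A) : Finset Q :=
  Finset.univ.image fun q => runWord δ q w

theorem wordImage_append (u v : List A) :
    wordImage δ (u ++ v) = (wordImage δ u).image fun q => runWord δ q v := by
  simp only [wordImage, Finset.image_image, runWord_append, comp_def]

/-- A word has minimal rank if no other word has a smaller image. -/
def IsMinRank (δ : Q → A → Q) (w : List A) : Prop :=
  ∀ u, (wordImage δ w).card ≤ (wordImage δ u).card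

theorem exists_isMinRank (δ : Q → A → Q) : ∃ w, IsMinRank δ w := by
  obtain ⟨w, hw⟩ := exists_minimalFor_of_wellFoundedLT (fun _ : List A => True)
    (fun w => (wordImage δ w).card) ⟨[], trivial⟩
  exact ⟨w, fun u => (le_total _ _).elim id fun h => hw.2 trivial h⟩

theorem IsMinRank.append {w : List A} (hw : IsMinRank δ w) (u : List A) :
    IsMinRank δ (w ++ u) := fun v =>
  le_trans (by rw [wordImage_append]; exact Finset.card_image_le) (hw v)

theorem IsMinRank.injOn {w : List A} (hw : IsMinRank δ w) (v : List A) :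
    Set.InjOn (fun q => runWord δ q v) (wordImage δ w) := by
  rw [← Finset.card_image_iff, ← wordImage_append]
  exact le_antisymm (hw.append v w) (hw _)

theorem exists_synchronizing_word [Nonempty Q]
    (h : ∀ p q : Q, ∃ w, runWord δ p w = runWord δ q w) :
    ∃ w q₀, ∀ q, runWord δ q w = q₀ := by
  obtain ⟨w, hw⟩ := exists_isMinRank δ
  refine ⟨w, runWord δ (Classical.arbitrary Q) w, fun q => ?_⟩
  obtain ⟨v, hv⟩ := h (runWord δ q w) (runWord δ (Classical.arbitrary Q) w)
  exact hw.injOn v (Finset.mem_image_of_mem _ (Finset.mem_univ _))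
    (Finset.mem_image_of_mem _ (Finset.mem_univ _)) hv

theorem exists_stable_of_hasDominantTree {g : Q → Q} {a : A}
    (hsc : ∀ p q, ∃ w, runWord δ p w = q) (hg : ∀ q, δ q a = g q) (hd : HasDominantTree g) :
    ∃ p q, p ≠ q ∧ Stable δ p q := by
  obtain ⟨n, r, ⟨v, hv⟩, hr⟩ := hd
  have : Nonempty Q := ⟨v⟩
  obtain ⟨p, hp⟩ := Finite.exists_max (height g)
  have hrun := runWord_replicate hg
  set L := height g p with hL
  have hnL : n < L := hv.trans_le (hp v)
  obtain ⟨w₀, hw₀⟩ := exists_isMinRank δ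
  obtain ⟨u₀, hu₀⟩ := hsc (runWord δ v w₀) p
  set w := w₀ ++ u₀
  have hwmin : IsMinRank δ w := hw₀.append _
  have hpw : p ∈ wordImage δ w :=
    Finset.mem_image.2 ⟨v, Finset.mem_univ _, by rw [runWord_append, hu₀]⟩
  have hlow : ∀ s ∈ wordImage δ w, s ≠ p → g^[L - 1] s ∈ periodicPts g := by
    intro s hs hsp
    refine iterate_mem_of_height_le (Nat.le_sub_one_of_lt ?_)
    refine lt_of_le_of_ne (hp s) fun he => hsp ?_
    refine hwmin.injOn (List.replicate L a) hs hpw ?_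
    have h1 := hr s (by omega)
    have h2 := hr p (by omega)
    rw [root, he] at h1
    rw [root, ← hL] at h2
    simp only [hrun, h1, h2]
  set p' := g^[L - 1] p with hp'
  have hp'per : p' ∉ periodicPts g := iterate_notMem (by omega)
  set N := (Fintype.card Q).factorial * L
  have hfix : ∀ s ∈ periodicPts g, g^[N] s = s := fun s hs =>
    (isPeriodicPt_factorial_card_of_mem_periodicPts hs).mul_const L
  set p'' := g^[N] p' with hp''
  have hp''per : p'' ∈ periodicPts g := by
    rw [hp'', hp', ← iterate_add_apply]
    exact iterate_mem_of_height_le ((Nat.le_mul_of_pos_left _ (Nat.factorial_pos _)).trans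
      (Nat.le_add_right _ _))
  set S := wordImage δ (w ++ List.replicate (L - 1) a) with hS
  have hSmin : IsMinRank δ (w ++ List.replicate (L - 1) a) := hwmin.append _
  have hSper : ∀ s ∈ S, s ≠ p' → s ∈ periodicPts g := by
    intro s hs hne
    rw [hS, wordImage_append] at hs
    obtain ⟨t, ht, rfl⟩ := Finset.mem_image.1 hs
    simp only [hrun] at hne ⊢
    exact hlow t ht fun e => hne (e ▸ rfl)
  have hp'S : p' ∈ S := by
    rw [hS, wordImage_append]
    exact Finset.mem_image.2 ⟨p, hpw, hrun _ _⟩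
  have hne : p' ≠ p'' := fun e => hp'per (e ▸ hp''per)
  refine ⟨p', p'', hne, ?_⟩
  by_contra hst
  simp only [Stable, not_forall, not_exists] at hst
  obtain ⟨u, hu⟩ := hst
  have hp''S : p'' ∉ S := fun h => hne <|
    hSmin.injOn (List.replicate N a) hp'S h (by simp only [hrun, hfix p'' hp''per, ← hp''])
  have hcross : ∀ s ∈ S, runWord δ s (u ++ w₀) ≠ runWord δ p'' (u ++ w₀) := by
    intro s hs he
    by_cases hsp : s = p'
    · exact hu w₀ (by rw [← runWord_append, ← runWord_append, ← hsp, he])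
    · refine hsp (hSmin.injOn (List.replicate N a ++ (u ++ w₀)) hs hp'S ?_)
      simp only [runWord_append _ (List.replicate N a), hrun, hfix s (hSper s hs hsp), ← hp'', he]
  have hcard : (insert p'' S).card ≤ (wordImage δ w₀).card := by
    refine Finset.card_le_card_of_injOn (fun q => runWord δ q (u ++ w₀)) (fun q _ => ?_) ?_
    · simp only [runWord_append]
      exact Finset.mem_image_of_mem _ (Finset.mem_univ _)
    · rw [Finset.coe_insert, Set.injOn_insert (by simpa using hp''S)]
      refine ⟨hSmin.injOn _, ?_⟩
      rintro ⟨s, hs, he⟩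
      exact hcross s hs he
  rw [Finset.card_insert_of_notMem hp''S] at hcard
  have : (wordImage δ w₀).card ≤ S.card := hw₀ _
  omega

end Automaton

section Walk

variable {V : Type*} {R : V → V → Prop}

/-- There is a walk of length `n` from `u` to `v` in the digraph `R`. -/
def HasWalk (R : V → V → Prop) (n : ℕ) (u v : V) : Prop :=
  ∃ g : ℕ → V, g 0 = u ∧ g n = v ∧ ∀ i < n, R (g i) (g (i + 1))

theorem hasWalk_zero (u : V) : HasWalk R 0 u u :=
  ⟨fun _ => u, rfl, rfl, fun i hi => absurd hi i.not_lt_zero⟩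

theorem HasWalk.cons {n : ℕ} {u v w : V} (huv : R u v) (h : HasWalk R n v w) :
    HasWalk R (n + 1) u w := by
  obtain ⟨g, rfl, rfl, hg⟩ := h
  refine ⟨fun i => Nat.casesOn i u g, rfl, rfl, fun i hi => ?_⟩
  cases i with
  | zero => exact huv
  | succ i => exact hg i (by omega)

theorem HasWalk.trans {m n : ℕ} {u v w : V} (huv : HasWalk R m u v) (hvw : HasWalk R n v w) :
    HasWalk R (m + n) u w := by
  induction m generalizing u with
  | zero =>
    obtain ⟨g, rfl, rfl, -⟩ := huv
    simpa using hvw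
  | succ m ih =>
    obtain ⟨g, rfl, rfl, hg⟩ := huv
    rw [Nat.add_right_comm]
    exact (ih ⟨fun i => g (i + 1), rfl, rfl, fun i hi => hg (i + 1) (by omega)⟩).cons
      (hg 0 m.succ_pos)

theorem exists_hasWalk {u v : V} (h : Relation.ReflTransGen R u v) : ∃ n, HasWalk R n u v := by
  induction h using Relation.ReflTransGen.head_induction_on with
  | refl => exact ⟨0, hasWalk_zero v⟩
  | head h _ ih => exact ih.imp' Nat.succ fun n hn => hn.cons h

theorem HasWalk.dvd {m n : ℕ} {v : V} (h : HasWalk R n v v)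
    (hm : ∀ v n, IsClosedWalk R v n → m ∣ n) : m ∣ n := by
  rcases Nat.eq_zero_or_pos n with rfl | hn
  · exact dvd_zero m
  · exact hm v n ⟨hn, h⟩

theorem hasWalk_runWord {A : Type*} {δ : V → A → V} (hδ : ∀ v a, R v (δ v a)) (v : V)
    (w : List A) : HasWalk R w.length v (runWord δ v w) := by
  induction w generalizing v with
  | nil => exact hasWalk_zero v
  | cons a w ih => exact (ih _).cons (hδ v a)

theorem HasWalk.iterate_eq {g : V → V} (hR : ∀ v w, R v w → w = g v) {n : ℕ} {u v : V}
    (h : HasWalk R n u v) : g^[n] u = v := by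
  obtain ⟨k, rfl, rfl, hk⟩ := h
  have : ∀ i ≤ n, g^[i] (k 0) = k i := by
    intro i hi
    induction i with
    | zero => rfl
    | succ i ih => rw [iterate_succ_apply', ih (by omega), hR _ _ (hk i hi)]
  exact this n le_rfl

/-- An aperiodic strongly connected digraph with at least two vertices has a branching vertex. -/
theorem exists_branch [Nontrivial V] (hE : ∀ v, ∃ w, R v w)
    (hsc : ∀ u v, Relation.ReflTransGen R u v)
    (hgcd : ∀ m, (∀ v n, IsClosedWalk R v n → m ∣ n) → m = 1) :
    ∃ p s t, R p s ∧ R p t ∧ s ≠ t := by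
  by_contra! H
  choose g hg using hE
  have hR : ∀ v w, R v w → w = g v := fun v w h => H v w (g v) h (hg v)
  have hit : ∀ u v, ∃ n, g^[n] u = v := fun u v =>
    (exists_hasWalk (hsc u v)).imp fun _ h => h.iterate_eq hR
  obtain ⟨x, y, hxy⟩ := exists_pair_ne V
  have hone : minimalPeriod g x = 1 := by
    refine hgcd _ fun v n hv => ?_
    have hn : IsPeriodicPt g n v := HasWalk.iterate_eq hR hv.2
    obtain ⟨k, rfl⟩ := hit v x
    exact (hn.apply_iterate k).minimalPeriod_dvd
  have hfix : IsFixedPt g x := minimalPeriod_eq_one_iff_isFixedPt.1 hone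
  obtain ⟨k, hk⟩ := hit x y
  exact hxy ((hfix.iterate k).symm.trans hk)

end Walk

section Coloring

variable {V : Type*} {d : ℕ}

theorem exists_stable_coloring [Finite V] [Nontrivial V] (hd : 0 < d) (f : V → Fin d → V)
    (hsc : ∀ u v : V, Relation.ReflTransGen (fun x y => ∃ i, f x i = y) u v)
    (hgcd : ∀ m : ℕ, (∀ v n, IsClosedWalk (fun x y => ∃ i, f x i = y) v n → m ∣ n) → m = 1) :
    ∃ π : V → Equiv.Perm (Fin d), ∃ p q, p ≠ q ∧ Stable (fun v c => f v (π v c)) p q := by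
  classical
  have := Fintype.ofFinite V
  have : Nonempty (Fin d) := ⟨⟨0, hd⟩⟩
  set E : V → V → Prop := fun x y => ∃ i, f x i = y
  by_cases hb : ∀ y z r, (∀ w, E y w → w = r) → (∀ w, E z w → w = r) → y = z
  · have hout : ∀ v, ∃ w, E v w := fun v => ⟨f v ⟨0, hd⟩, _, rfl⟩
    have hpred : ∀ p, ∃ b, E b p := by
      intro p
      obtain ⟨q, hq⟩ := exists_ne p
      rcases (hsc q p).cases_tail with h | ⟨b, -, hb⟩
      · exact absurd h.symm hq
      · exact ⟨b, hb⟩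
    obtain ⟨h, hh, hdom⟩ := exists_hasDominantTree hout hpred hb (exists_branch hout hsc hgcd)
    choose i hi using hh
    refine ⟨fun v => Equiv.swap ⟨0, hd⟩ (i v), exists_stable_of_hasDominantTree (a := ⟨0, hd⟩)
      (fun p q => exists_runWord_eq (Relation.ReflTransGen.mono ?_ _ _ (hsc p q)))
      (fun q => ?_) hdom⟩
    · rintro x _ ⟨j, rfl⟩
      exact ⟨(Equiv.swap ⟨0, hd⟩ (i x)).symm j, by rw [Equiv.apply_symm_apply]⟩
    · rw [Equiv.swap_apply_left, hi]
  · push Not at hb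
    obtain ⟨y, z, r, hy, hz, hyz⟩ := hb
    exact ⟨1, y, z, hyz, stable_of_forall_step_eq fun a =>
      (hy _ ⟨_, rfl⟩).trans (hz _ ⟨_, rfl⟩).symm⟩

theorem exists_synchronizing_coloring [Finite V] [Nonempty V] (hd : 0 < d) (f : V → Fin d → V)
    (hsc : ∀ u v : V, Relation.ReflTransGen (fun x y => ∃ i, f x i = y) u v)
    (hgcd : ∀ m : ℕ, (∀ v n, IsClosedWalk (fun x y => ∃ i, f x i = y) v n → m ∣ n) → m = 1) :
    ∃ π : V → Equiv.Perm (Fin d), ∃ w : List (Fin d), ∃ q₀ : V,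
      ∀ q : V, runWord (fun v c => f v (π v c)) q w = q₀ := by
  induction hn : Nat.card V using Nat.strong_induction_on generalizing V with
  | _ n ih =>
  subst hn
  classical
  have := Fintype.ofFinite V
  rcases subsingleton_or_nontrivial V with hV | hV
  · exact ⟨1, [], Classical.arbitrary V, fun q => Subsingleton.elim _ _⟩
  obtain ⟨π, p, q, hpq, hst⟩ := exists_stable_coloring hd f hsc hgcd
  set δ : V → Fin d → V := fun v c => f v (π v c) with hδ
  have hstep : ∀ x y, (∃ i, f x i = y) → ∃ i, quotientStep δ (Quotient.mk _ x) i =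
      Quotient.mk _ y := by
    rintro x _ ⟨i, rfl⟩
    refine ⟨(π x).symm i, congrArg (Quotient.mk (stableSetoid δ)) ?_⟩
    simp only [hδ, Equiv.apply_symm_apply]
  have hlt : Nat.card (Quotient (stableSetoid δ)) < Nat.card V := by
    have := Fintype.ofFinite (Quotient (stableSetoid δ))
    rw [Nat.card_eq_fintype_card, Nat.card_eq_fintype_card]
    exact Fintype.card_lt_of_surjective_not_injective (Quotient.mk (stableSetoid δ))
      Quotient.mk_surjective fun hinj => hpq (hinj (Quotient.sound hst))
  have : Nonempty (Quotient (stableSetoid δ)) := ⟨Quotient.mk _ p⟩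
  obtain ⟨σ, w, X, hw⟩ := ih _ hlt (quotientStep δ)
    (by
      rintro ⟨u⟩ ⟨v⟩
      exact (hsc u v).lift _ hstep)
    (fun m hm => hgcd m fun v n ⟨hpos, g, h0, h1, hg⟩ => hm (Quotient.mk _ v) n
      ⟨hpos, fun i => Quotient.mk _ (g i), congrArg _ h0, congrArg _ h1,
        fun i hi => hstep _ _ (hg i hi)⟩)
    rfl
  exact ⟨fun v => (σ (Quotient.mk _ v)).trans (π v),
    exists_synchronizing_word (δ := recolor δ σ) (exists_merge_recolor hw)⟩

theorem eq_one_of_synchronizing [Nonempty V] (hd : 0 < d) {f : V → Fin d → V}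
    (hsc : ∀ u v : V, Relation.ReflTransGen (fun x y => ∃ i, f x i = y) u v)
    {π : V → Equiv.Perm (Fin d)} {w : List (Fin d)} {q₀ : V}
    (hw : ∀ q : V, runWord (fun v c => f v (π v c)) q w = q₀) {m : ℕ}
    (hm : ∀ v n, IsClosedWalk (fun x y => ∃ i, f x i = y) v n → m ∣ n) : m = 1 := by
  have hwalk : ∀ q, HasWalk (fun x y => ∃ i, f x i = y) w.length q q₀ := fun q =>
    hw q ▸ hasWalk_runWord (fun v c => ⟨π v c, rfl⟩) q w
  obtain ⟨k, hk⟩ := exists_hasWalk (hsc q₀ q₀)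
  have h1 := ((hwalk q₀).trans hk).dvd hm
  have h2 := (((hwalk (f q₀ ⟨0, hd⟩)).trans hk).cons ⟨_, rfl⟩).dvd hm
  exact Nat.dvd_one.1 ((Nat.dvd_add_right h1).1 h2)

end Coloring

end RoadColoring

/-- Road Coloring Theorem: a finite strongly connected digraph of uniform
outdegree `d` (edges of vertex `v` enumerated as `f v 0, …, f v (d-1)`) admits a
synchronizing coloring iff the gcd of the lengths of all its cycles is 1.
A coloring is a choice of a bijection `π v` between outgoing edges and colors at
each vertex; gcd-is-one is phrased as: every common divisor of all cycle lengths equals 1. -/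
theorem road_coloring {V : Type*} [Fintype V] [Nonempty V] {d : ℕ} (hd : 0 < d)
    (f : V → Fin d → V)
    (hsc : ∀ u v : V, Relation.ReflTransGen (fun x y => ∃ i, f x i = y) u v) :
    (∃ π : V → Equiv.Perm (Fin d), ∃ w : List (Fin d), ∃ q0 : V,
        ∀ q : V, runWord (fun v c => f v (π v c)) q w = q0) ↔
      (∀ m : ℕ, (∀ v n, IsClosedWalk (fun x y => ∃ i, f x i = y) v n → m ∣ n) → m = 1) :=
  ⟨fun ⟨_, _, _, hw⟩ _ hm => RoadColoring.eq_one_of_synchronizing hd hsc hw hm,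
    RoadColoring.exists_synchronizing_coloring hd f hsc⟩
end

section
/- For any finite strongly connected digraph of uniform outdegree, let k be the greatest common divisor of the lengths of all its cycles. Then the digraph admits a k-synchronizing coloring, and k is minimal: no coloring admits an m-synchronizing word with m < k. -/
section RedCycles

open Function

variable {V : Type*}

/-- The number of steps after which the orbit of `x` under `g` becomes periodic. -/
noncomputable def cycleLevel (g : V → V) (x : V) : ℕ := sInf {n | g^[n] x ∈ periodicPts g}

/-- The first periodic point on the orbit of `x` under `g`. -/
noncomputable def cycleRoot (g : V → V) (x : V) : V := g^[cycleLevel g x] x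

/-- For some `n`, there are points which are not periodic after `n` steps, and all of them have
eventually equal orbits. -/
def DeepPointsMerge (g : V → V) : Prop :=
  ∃ n, (∃ p, g^[n] p ∉ periodicPts g) ∧
    ∀ x y, g^[n] x ∉ periodicPts g → g^[n] y ∉ periodicPts g → ∃ j, g^[j] x = g^[j] y

lemma iterate_mem_periodicPts {g : V → V} {x : V} (hx : x ∈ periodicPts g) (n : ℕ) :
    g^[n] x ∈ periodicPts g := by
  induction n with
  | zero => exact hx
  | succ n ih =>
    rw [iterate_succ_apply']
    exact (bijOn_periodicPts g).mapsTo ih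

lemma exists_iterate_mem_periodicPts [Finite V] (g : V → V) (x : V) :
    ∃ n, g^[n] x ∈ periodicPts g := by
  obtain ⟨i, j, hne, hij⟩ := Finite.exists_ne_map_eq_of_infinite fun n : ℕ => g^[n] x
  wlog hlt : i < j generalizing i j
  · exact this j i hne.symm hij.symm (by omega)
  refine ⟨i, mk_mem_periodicPts (n := j - i) (by omega) ?_⟩
  change g^[j - i] (g^[i] x) = g^[i] x
  rw [← iterate_add_apply, Nat.sub_add_cancel hlt.le]
  exact hij.symm

lemma iterate_mem_periodicPts_iff [Finite V] {g : V → V} {x : V} {n : ℕ} :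
    g^[n] x ∈ periodicPts g ↔ cycleLevel g x ≤ n := by
  refine ⟨fun h => Nat.sInf_le h, fun h => ?_⟩
  have h0 : g^[cycleLevel g x] x ∈ periodicPts g :=
    Nat.sInf_mem (s := {n | g^[n] x ∈ periodicPts g}) (exists_iterate_mem_periodicPts g x)
  have := iterate_mem_periodicPts h0 (n - cycleLevel g x)
  rwa [← iterate_add_apply, Nat.sub_add_cancel h] at this

lemma mem_periodicPts_iff_cycleLevel [Finite V] {g : V → V} {x : V} :
    x ∈ periodicPts g ↔ cycleLevel g x = 0 := by
  rw [← Nat.le_zero]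
  exact iterate_mem_periodicPts_iff (n := 0)

lemma cycleRoot_mem [Finite V] (g : V → V) (x : V) : cycleRoot g x ∈ periodicPts g :=
  iterate_mem_periodicPts_iff.2 le_rfl

lemma cycleLevel_iterate [Finite V] (g : V → V) (x : V) (i : ℕ) :
    cycleLevel g (g^[i] x) = cycleLevel g x - i := by
  have key : ∀ n, cycleLevel g (g^[i] x) ≤ n ↔ cycleLevel g x ≤ n + i := fun n => by
    rw [← iterate_mem_periodicPts_iff, ← iterate_mem_periodicPts_iff, iterate_add_apply]
  have h1 := (key (cycleLevel g (g^[i] x))).1 le_rfl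
  have h2 := (key (cycleLevel g x - i)).2 (by omega)
  omega

lemma cycleRoot_iterate [Finite V] {g : V → V} {x : V} {i : ℕ}
    (h : g^[i] x ∉ periodicPts g) : cycleRoot g (g^[i] x) = cycleRoot g x := by
  rw [iterate_mem_periodicPts_iff, not_le] at h
  rw [cycleRoot, cycleRoot, cycleLevel_iterate, ← iterate_add_apply, Nat.sub_add_cancel h.le]

lemma deepPointsMerge_of_cycleRoot_eq [Finite V] {g : V → V} {l : ℕ} {z : V}
    (hp : ∃ p, l < cycleLevel g p) (hz : ∀ x, l < cycleLevel g x → cycleRoot g x = z) :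
    DeepPointsMerge g := by
  obtain ⟨p, hp⟩ := hp
  have : Nonempty V := ⟨p⟩
  obtain ⟨q, hq⟩ := Finite.exists_max (cycleLevel g)
  have hlq := hp.trans_le (hq p)
  have key : ∀ x, g^[cycleLevel g q - 1] x ∉ periodicPts g → g^[cycleLevel g q] x = z := by
    intro x hx
    rw [iterate_mem_periodicPts_iff, not_le] at hx
    have h1 := hq x
    have h2 : cycleLevel g x = cycleLevel g q := by omega
    rw [← h2]
    exact hz x (by omega)
  refine ⟨cycleLevel g q - 1, ⟨q, ?_⟩, fun x y hx hy => ⟨_, (key x hx).trans (key y hy).symm⟩⟩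
  rw [iterate_mem_periodicPts_iff]
  omega

lemma update_iterate_of_ne [DecidableEq V] {g : V → V} {u p x : V} {n : ℕ}
    (h : ∀ j < n, g^[j] x ≠ u) : (update g u p)^[n] x = g^[n] x := by
  induction n with
  | zero => rfl
  | succ n ih =>
    rw [iterate_succ_apply', iterate_succ_apply', ih fun j hj => h j (by omega),
      update_of_ne (h n (by omega))]

lemma mem_periodicPts_congr {g g' : V → V} {x : V} (h : ∀ n, g'^[n] x = g^[n] x) :
    x ∈ periodicPts g' ↔ x ∈ periodicPts g := by
  simp only [mem_periodicPts, IsPeriodicPt, IsFixedPt, h]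

lemma cycleLevel_congr {g g' : V → V} {x : V} (h : ∀ n, g'^[n] x = g^[n] x) :
    cycleLevel g' x = cycleLevel g x := by
  have : ∀ n, g'^[n] x ∈ periodicPts g' ↔ g^[n] x ∈ periodicPts g := by
    intro n
    rw [h n]
    refine mem_periodicPts_congr fun m => ?_
    rw [← iterate_add_apply, ← h, ← h, iterate_add_apply]
  simp only [cycleLevel, this]

lemma exists_iterate_eq_of_mem_periodicPts {g : V → V} {t y : V} {a : ℕ}
    (hy : y ∈ periodicPts g) (ha : g^[a] y = t) :
    ∃ i, g^[i] (g t) = y ∧ ∀ j < i, g^[j] (g t) ≠ t := by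
  classical
  have hex : ∃ i, g^[i] (g t) = y := by
    obtain ⟨n, hn, hper⟩ := hy
    refine ⟨n * (a + 1) - (a + 1), ?_⟩
    rw [← ha, ← iterate_succ_apply' g, ← iterate_add_apply,
      Nat.sub_add_cancel (Nat.le_mul_of_pos_left _ hn)]
    exact hper.mul_const _
  refine ⟨Nat.find hex, Nat.find_spec hex, fun j hj hjt => ?_⟩
  refine Nat.find_min hex (m := Nat.find hex - (j + 1)) (by omega) ?_
  have h1 : g^[j + 1] (g t) = g t := by rw [iterate_succ_apply', hjt]
  have h2 := congrArg g^[Nat.find hex - (j + 1)] h1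
  rw [← iterate_add_apply, Nat.sub_add_cancel hj, Nat.find_spec hex] at h2
  exact h2.symm

/-- Points of the cycle through `t` are reached from `g t` without using the edge out of `t`. -/
lemma exists_update_iterate_eq [DecidableEq V] {g : V → V} {t y : V} (h : V) {a : ℕ}
    (hy : y ∈ periodicPts g) (ha : g^[a] y = t) :
    ∃ i, g^[i] (g t) = y ∧ (update g t h)^[i] (g t) = y := by
  obtain ⟨i, hi, hne⟩ := exists_iterate_eq_of_mem_periodicPts hy ha
  exact ⟨i, hi, (update_iterate_of_ne hne).trans hi⟩

/-- Redirecting a periodic point does not change the way to the cycles. -/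
lemma update_iterate_of_le_cycleLevel [Finite V] [DecidableEq V] {g : V → V} {t : V} (h : V)
    (ht : t ∈ periodicPts g) {x : V} {n : ℕ} (hn : n ≤ cycleLevel g x) :
    (update g t h)^[n] x = g^[n] x := by
  refine update_iterate_of_ne fun j hj hjt => ?_
  rw [← hjt, iterate_mem_periodicPts_iff] at ht
  omega

/-- Redirect the cycle edge entering the root of a point of maximal level, in a selector `g` with
the largest possible number of periodic points. -/
lemma deepPointsMerge_update_of_mem_periodicPts [Finite V] [DecidableEq V] {g : V → V}
    {p t h : V} (hp : ∀ x, cycleLevel g x ≤ cycleLevel g p) (ht : t ∈ periodicPts g)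
    (hr : g t = cycleRoot g p) (hh : h ≠ g t)
    (hmax : (periodicPts (update g t h)).ncard ≤ (periodicPts g).ncard) :
    DeepPointsMerge (update g t h) := by
  set g' := update g t h with hg'
  have hunch : ∀ x, (∀ a, g^[a] x ≠ t) → ∀ n, g'^[n] x = g^[n] x :=
    fun x hx n => update_iterate_of_ne fun j _ => hx j
  have hrn : g t ∉ periodicPts g' := by
    intro hmem
    have hsub : periodicPts g ⊆ periodicPts g' := by
      intro y hy
      by_cases hyt : ∃ a, g^[a] y = t
      · obtain ⟨a, ha⟩ := hyt
        obtain ⟨i, -, hi⟩ := exists_update_iterate_eq h hy ha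
        rw [← hi]
        exact iterate_mem_periodicPts hmem i
      · push Not at hyt
        exact (mem_periodicPts_congr (hunch y hyt)).2 hy
    have heq := Set.eq_of_subset_of_ncard_le hsub hmax (Set.toFinite _)
    obtain ⟨y, hy, hyr⟩ := (bijOn_periodicPts g').surjOn hmem
    have hyt : y ≠ t := by
      rintro rfl
      rw [hg', update_self] at hyr
      exact hh hyr
    rw [hg', update_of_ne hyt] at hyr
    exact hyt ((bijOn_periodicPts g).injOn (heq ▸ hy) ht hyr)
  refine deepPointsMerge_of_cycleRoot_eq (l := cycleLevel g p) (z := cycleRoot g' (g t))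
    ⟨p, ?_⟩ fun x hx => ?_
  · by_contra! hle
    rw [← iterate_mem_periodicPts_iff, hg', update_iterate_of_le_cycleLevel h ht le_rfl] at hle
    rw [hr] at hrn
    exact hrn hle
  · by_cases hxt : ∃ a, g^[a] x = t
    · obtain ⟨a, ha⟩ := hxt
      have hx' : g'^[cycleLevel g x] x = cycleRoot g x :=
        update_iterate_of_le_cycleLevel h ht le_rfl
      have hnot : g'^[cycleLevel g x] x ∉ periodicPts g' := by
        rw [iterate_mem_periodicPts_iff]
        have := hp x
        omega
      have hra : g^[a - cycleLevel g x] (cycleRoot g x) = t := by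
        rw [← ha, iterate_mem_periodicPts_iff] at ht
        rw [cycleRoot, ← iterate_add_apply, Nat.sub_add_cancel ht, ha]
      obtain ⟨i, -, hi⟩ := exists_update_iterate_eq h (cycleRoot_mem g x) hra
      rw [← cycleRoot_iterate hnot]
      rw [hx', ← hi] at hnot ⊢
      exact cycleRoot_iterate hnot
    · push Not at hxt
      have := cycleLevel_congr (hunch x hxt)
      have := hp x
      omega

/-- Redirecting `u` to a point `p` of maximal level whose orbit avoids `u`. -/
lemma deepPointsMerge_update_of_notMem_orbit [Finite V] [DecidableEq V] {g : V → V} {p u : V}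
    (hp : ∀ x, cycleLevel g x ≤ cycleLevel g p) (hpos : p ∉ periodicPts g)
    (hu : ∀ a, g^[a] p ≠ u) : DeepPointsMerge (update g u p) := by
  set g' := update g u p with hg'
  have hunch : ∀ x, (∀ a, g^[a] x ≠ u) → ∀ n, g'^[n] x = g^[n] x :=
    fun x hx n => update_iterate_of_ne fun j _ => hx j
  have hup : g' u = p := update_self ..
  have hp' : p ∉ periodicPts g' := fun h => hpos ((mem_periodicPts_congr (hunch p hu)).1 h)
  have hu' : u ∉ periodicPts g' := fun h => hp' (hup ▸ (bijOn_periodicPts g').mapsTo h)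
  have hlev : cycleLevel g' u - 1 = cycleLevel g p := by
    rw [← cycleLevel_congr (hunch p hu), ← hup]
    exact (cycleLevel_iterate g' u 1).symm
  rw [mem_periodicPts_iff_cycleLevel] at hu'
  refine deepPointsMerge_of_cycleRoot_eq (l := cycleLevel g p) (z := cycleRoot g' u)
    ⟨u, by omega⟩ fun x hx => ?_
  have hex : ∃ a, g^[a] x = u := by
    by_contra! hxu
    have := cycleLevel_congr (hunch x hxu)
    have := hp x
    omega
  classical
  have hi : g'^[Nat.find hex] x = u :=
    (update_iterate_of_ne fun j hj => Nat.find_min hex hj).trans (Nat.find_spec hex)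
  rw [← mem_periodicPts_iff_cycleLevel] at hu'
  rw [← hi] at hu' ⊢
  exact (cycleRoot_iterate hu').symm

/-- Redirecting a non-periodic point `u` of the orbit of `p` to `p` creates a new cycle. -/
lemma ncard_periodicPts_lt_update [Finite V] [DecidableEq V] {g : V → V} {p u : V}
    (hpos : p ∉ periodicPts g) (hu : u ∉ periodicPts g) (hpu : ∃ a, g^[a] p = u) :
    (periodicPts g).ncard < (periodicPts (update g u p)).ncard := by
  classical
  refine Set.ncard_lt_ncard ((Set.ssubset_iff_of_subset fun y hy => ?_).2 ⟨p, ?_, hpos⟩)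
    (Set.toFinite _)
  · refine (mem_periodicPts_congr fun n => update_iterate_of_ne fun j _ hju => hu ?_).2 hy
    exact hju ▸ iterate_mem_periodicPts hy j
  · refine mk_mem_periodicPts (n := Nat.find hpu + 1) (by omega) ?_
    change (update g u p)^[_] p = p
    rw [iterate_succ_apply', update_iterate_of_ne fun j hj => Nat.find_min hpu hj,
      Nat.find_spec hpu, update_self]

/-- Redirecting a cycle vertex `u` to a point `p` of maximal level whose orbit runs into that
cycle: the orbit of `p` becomes part of the cycle, in place of the old arc from `g u` to `t`. -/
lemma deepPointsMerge_or_of_update [Finite V] [DecidableEq V] {g : V → V} {p u t : V}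
    (hp : ∀ x, cycleLevel g x ≤ cycleLevel g p) (hpos : p ∉ periodicPts g)
    (hu : u ∈ periodicPts g) (hpu : ∃ a, g^[a] p = u) (ht : t ∈ periodicPts g)
    (hr : g t = cycleRoot g p) (hut : u ≠ t)
    (hmax : (periodicPts (update g u p)).ncard ≤ (periodicPts g).ncard) :
    DeepPointsMerge (update g u p) ∨
      ∃ q s, (∀ x, cycleLevel (update g u p) x ≤ cycleLevel (update g u p) q) ∧
        s ∉ periodicPts g ∧ g s = cycleRoot g p ∧ s ∈ periodicPts (update g u p) ∧
        update g u p s = g s ∧ cycleRoot (update g u p) q = g s ∧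
        (periodicPts g).ncard ≤ (periodicPts (update g u p)).ncard := by
  classical
  set g' := update g u p with hg'
  have hunch : ∀ x, (∀ a, g^[a] x ≠ u) → ∀ n, g'^[n] x = g^[n] x :=
    fun x hx n => update_iterate_of_ne fun j _ => hx j
  have hlevpos : 0 < cycleLevel g p :=
    Nat.pos_of_ne_zero fun h => hpos (mem_periodicPts_iff_cycleLevel.2 h)
  have hpre : ∀ n ≤ cycleLevel g p, g'^[n] p = g^[n] p :=
    fun n hn => update_iterate_of_le_cycleLevel p hu hn
  have hp' : p ∈ periodicPts g' := by
    refine mk_mem_periodicPts (n := Nat.find hpu + 1) (by omega) ?_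
    change g'^[_] p = p
    rw [iterate_succ_apply', update_iterate_of_ne fun j hj => Nat.find_min hpu hj,
      Nat.find_spec hpu, hg', update_self]
  obtain ⟨l, hl⟩ : ∃ l, cycleLevel g p = l + 1 := ⟨cycleLevel g p - 1, by omega⟩
  set s := g^[l] p with hs
  have hgs : g s = cycleRoot g p := by rw [cycleRoot, hl, iterate_succ_apply']
  have hsn : s ∉ periodicPts g := by rw [hs, iterate_mem_periodicPts_iff]; omega
  have hs' : s ∈ periodicPts g' := by
    rw [hs, ← hpre l (by omega)]
    exact iterate_mem_periodicPts hp' l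
  have hg's : g' s = g s := update_of_ne (by rintro h; exact hsn (h ▸ hu)) _ _
  have hg't : g' t = g t := update_of_ne hut.symm _ _
  have ht' : t ∉ periodicPts g' := fun h => hsn <| by
    rwa [(bijOn_periodicPts g').injOn hs' h (by rw [hg's, hg't, hgs, hr])]
  obtain ⟨b, hb⟩ : ∃ b, g^[b] t = u := by
    obtain ⟨a, ha⟩ := hpu
    have hla : cycleLevel g p ≤ a := by rwa [← iterate_mem_periodicPts_iff, ha]
    refine ⟨a - cycleLevel g p + 1, ?_⟩
    rw [iterate_succ_apply, hr, cycleRoot, ← iterate_add_apply, Nat.sub_add_cancel hla, ha]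
  obtain ⟨m, hm, hmne⟩ := exists_iterate_eq_of_mem_periodicPts ht hb
  have hm' : ∀ i ≤ m, g'^[i] (g u) = g^[i] (g u) :=
    fun i hi => update_iterate_of_ne fun j hj => hmne j (by omega)
  have hlevc : cycleLevel g' (g u) = m + 1 := by
    apply le_antisymm
    · rw [← iterate_mem_periodicPts_iff, iterate_succ_apply', hm' m le_rfl, hm, hg't, hr, ← hgs,
        ← hg's]
      exact (bijOn_periodicPts g').mapsTo hs'
    · by_contra! h
      apply ht'
      rw [← hm, ← hm' m le_rfl, iterate_mem_periodicPts_iff]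
      omega
  have hrootc : cycleRoot g' (g u) = g s := by
    rw [cycleRoot, hlevc, iterate_succ_apply', hm' m le_rfl, hm, hg't, hr, hgs]
  have hroot : ∀ x, cycleLevel g p < cycleLevel g' x → cycleRoot g' x = g s := by
    intro x hx
    by_cases hxu : ∃ a, g^[a] x = u
    · obtain ⟨a, ha⟩ := hxu
      have hx' : g'^[cycleLevel g x] x = cycleRoot g x :=
        update_iterate_of_le_cycleLevel p hu le_rfl
      have hnot : g'^[cycleLevel g x] x ∉ periodicPts g' := by
        rw [iterate_mem_periodicPts_iff]
        have := hp x
        omega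
      have hra : g^[a - cycleLevel g x] (cycleRoot g x) = u := by
        rw [← ha, iterate_mem_periodicPts_iff] at hu
        rw [cycleRoot, ← iterate_add_apply, Nat.sub_add_cancel hu, ha]
      obtain ⟨i, -, hi⟩ := exists_update_iterate_eq p (cycleRoot_mem g x) hra
      rw [← cycleRoot_iterate hnot, ← hrootc]
      rw [hx', ← hi] at hnot ⊢
      exact cycleRoot_iterate hnot
    · push Not at hxu
      have := cycleLevel_congr (hunch x hxu)
      have := hp x
      omega
  by_cases hdeep : ∃ x, cycleLevel g p < cycleLevel g' x
  · exact Or.inl (deepPointsMerge_of_cycleRoot_eq hdeep hroot)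
  push Not at hdeep
  have hlost : (periodicPts g \ periodicPts g').ncard ≤ m + 1 := by
    have hsub : periodicPts g \ periodicPts g' ⊆
        ((Finset.range (m + 1)).image fun j => g'^[j] (g u) : Finset V) := by
      rintro y ⟨hy, hy'⟩
      by_cases hyu : ∃ a, g^[a] y = u
      · obtain ⟨a, ha⟩ := hyu
        obtain ⟨i, -, hi⟩ := exists_update_iterate_eq p hy ha
        rw [← hi, iterate_mem_periodicPts_iff, hlevc] at hy'
        simp only [Finset.coe_image, Set.mem_image, Finset.coe_range, Set.mem_Iio]
        exact ⟨i, by omega, hi⟩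
      · push Not at hyu
        exact absurd ((mem_periodicPts_congr (hunch y hyu)).2 hy) hy'
    refine (Set.ncard_le_ncard hsub (Set.toFinite _)).trans ?_
    rw [Set.ncard_coe_finset]
    exact Finset.card_image_le.trans (Finset.card_range _).le
  have hgain : cycleLevel g p ≤ (periodicPts g' \ periodicPts g).ncard := by
    have hsub : (((Finset.range (cycleLevel g p)).image fun j => g^[j] p : Finset V) : Set V) ⊆
        periodicPts g' \ periodicPts g := by
      intro y hy
      simp only [Finset.coe_image, Set.mem_image, Finset.coe_range, Set.mem_Iio] at hy
      obtain ⟨j, hj, rfl⟩ := hy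
      refine ⟨?_, by rw [iterate_mem_periodicPts_iff]; omega⟩
      rw [← hpre j hj.le]
      exact iterate_mem_periodicPts hp' j
    refine le_trans ?_ (Set.ncard_le_ncard hsub (Set.toFinite _))
    rw [Set.ncard_coe_finset, Finset.card_image_of_injOn, Finset.card_range]
    intro i hi j hj hij
    simp only [Finset.coe_range, Set.mem_Iio] at hi hj
    have h1 := cycleLevel_iterate g p i
    have h2 := cycleLevel_iterate g p j
    simp only at hij
    rw [hij] at h1
    omega
  have h1 := Set.ncard_sdiff_add_ncard (periodicPts g) (periodicPts g')
  have h2 := Set.ncard_sdiff_add_ncard (periodicPts g') (periodicPts g)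
  rw [Set.union_comm] at h2
  have h3 := hdeep (g u)
  refine Or.inr ⟨g u, s, fun x => ?_, hsn, hgs, hs', hg's, hrootc, by omega⟩
  have := hdeep x
  omega

lemma exists_selector_deepPointsMerge [Finite V] {R : V → V → Prop}
    (hsc : ∀ u v, Relation.ReflTransGen R u v) (hout : ∀ v, ∃ w, R v w)
    (hbunch : ∀ s t r, s ≠ t → R s r → R t r → (∃ x, R s x ∧ x ≠ r) ∨ ∃ x, R t x ∧ x ≠ r)
    (hmeet : ∃ s t r, s ≠ t ∧ R s r ∧ R t r) :
    ∃ g : V → V, (∀ v, R v (g v)) ∧ DeepPointsMerge g := by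
  classical
  choose g₀ hg₀ using hout
  have : Nonempty {g : V → V // ∀ v, R v (g v)} := ⟨⟨g₀, hg₀⟩⟩
  obtain ⟨⟨g, hg⟩, hmax⟩ := Finite.exists_max
    fun g : {g : V → V // ∀ v, R v (g v)} => (periodicPts g.1).ncard
  replace hmax : ∀ g' : V → V, (∀ v, R v (g' v)) →
      (periodicPts g').ncard ≤ (periodicPts g).ncard := fun g' hg' => hmax ⟨g', hg'⟩
  have hupd : ∀ {g : V → V}, (∀ v, R v (g v)) → ∀ {u p}, R u p → ∀ v, R v (update g u p v) := by
    intro g hg u p hup v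
    by_cases h : v = u
    · rw [h, update_self]
      exact hup
    · rw [update_of_ne h]
      exact hg v
  obtain ⟨s₀, t₀, r₀, hst₀, hs₀, ht₀⟩ := hmeet
  have : Nonempty V := ⟨r₀⟩
  obtain ⟨p, hp⟩ := Finite.exists_max (cycleLevel g)
  by_cases hpos : p ∈ periodicPts g
  · have hall : ∀ x, cycleLevel g x = 0 := fun x => by
      have := hp x
      rw [mem_periodicPts_iff_cycleLevel] at hpos
      omega
    obtain ⟨t, x, htx, hx⟩ : ∃ t x, R t x ∧ x ≠ g t := by
      have key : ∀ s, R s r₀ → (∃ x, R s x ∧ x ≠ r₀) → ∃ t x, R t x ∧ x ≠ g t := by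
        rintro s hs ⟨x, hsx, hx⟩
        by_cases h : x = g s
        · exact ⟨s, r₀, hs, fun h' => hx (h.trans h'.symm)⟩
        · exact ⟨s, x, hsx, h⟩
      rcases hbunch s₀ t₀ r₀ hst₀ hs₀ ht₀ with h | h
      · exact key _ hs₀ h
      · exact key _ ht₀ h
    refine ⟨_, hupd hg htx, deepPointsMerge_update_of_mem_periodicPts (p := g t)
      (fun y => by rw [hall y, hall]) (mem_periodicPts_iff_cycleLevel.2 (hall t)) ?_ hx
      (hmax _ (hupd hg htx))⟩
    rw [cycleRoot, hall]
    rfl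
  · obtain ⟨u, hup⟩ : ∃ u, R u p := by
      rcases Relation.ReflTransGen.cases_tail (hsc (cycleRoot g p) p) with h | ⟨u, -, hu⟩
      · exact absurd (h ▸ cycleRoot_mem g p) hpos
      · exact ⟨u, hu⟩
    by_cases hpu : ∃ a, g^[a] p = u
    swap
    · push Not at hpu
      exact ⟨_, hupd hg hup, deepPointsMerge_update_of_notMem_orbit hp hpos hpu⟩
    by_cases hu : u ∈ periodicPts g
    swap
    · exact absurd (hmax _ (hupd hg hup)) (ncard_periodicPts_lt_update hpos hu hpu).not_ge
    obtain ⟨t, ht, htr⟩ := (bijOn_periodicPts g).surjOn (cycleRoot_mem g p)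
    by_cases htx : ∃ x, R t x ∧ x ≠ g t
    · obtain ⟨x, htx, hx⟩ := htx
      exact ⟨_, hupd hg htx, deepPointsMerge_update_of_mem_periodicPts hp ht htr hx
        (hmax _ (hupd hg htx))⟩
    have hut : u ≠ t := by
      rintro rfl
      refine htx ⟨p, hup, fun h => hpos ?_⟩
      rw [h, htr]
      exact cycleRoot_mem g p
    have hg' := hupd hg hup
    rcases deepPointsMerge_or_of_update hp hpos hu hpu ht htr hut (hmax _ hg') with
      h | ⟨q, s, hq, hsn, hgs, hs', hg's, hroot, hcard⟩
    · exact ⟨_, hg', h⟩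
    have hst : s ≠ t := fun h => hsn (h ▸ ht)
    rcases hbunch s t (g s) hst (hg s) (hgs.trans htr.symm ▸ hg t) with ⟨x, hsx, hx⟩ | ⟨x, hx⟩
    · refine ⟨_, hupd hg' hsx, deepPointsMerge_update_of_mem_periodicPts hq hs' ?_ ?_
        ((hmax _ (hupd hg' hsx)).trans hcard)⟩
      · rw [hg's, hroot]
      · rwa [hg's]
    · rw [hgs, ← htr] at hx
      exact absurd ⟨x, hx⟩ htx

end RedCycles

section Automata

open Function

universe u

variable {V : Type u} {A : Type*}

lemma runWord_append (δ : V → A → V) (q : V) (w w' : List A) :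
    runWord δ q (w ++ w') = runWord δ (runWord δ q w) w' := List.foldl_append ..

lemma runWord_replicate (δ : V → A → V) (q : V) (a : A) (n : ℕ) :
    runWord δ q (List.replicate n a) = (fun v => δ v a)^[n] q := by
  induction n generalizing q with
  | zero => rfl
  | succ n ih => exact ih _

lemma reflTransGen_iff_exists_runWord {δ : V → A → V} {p q : V} :
    Relation.ReflTransGen (fun x y => ∃ i, δ x i = y) p q ↔ ∃ w, runWord δ p w = q := by
  constructor
  · intro h
    induction h with
    | refl => exact ⟨[], rfl⟩
    | tail _ h ih =>
      obtain ⟨w, rfl⟩ := ih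
      obtain ⟨i, rfl⟩ := h
      exact ⟨w ++ [i], runWord_append ..⟩
  · rintro ⟨w, rfl⟩
    induction w generalizing p with
    | nil => exact .refl
    | cons a w ih => exact .head ⟨a, rfl⟩ ih

/-- Two states are stable if, after reading any word, they can still be merged. -/
def StablePair (δ : V → A → V) (p q : V) : Prop :=
  ∀ u, ∃ w, runWord δ p (u ++ w) = runWord δ q (u ++ w)

/-- Stability is an equivalence relation. -/
def stableSetoid (δ : V → A → V) : Setoid V where
  r := StablePair δ
  iseqv :=
    { refl := fun _ _ => ⟨[], rfl⟩
      symm := fun h u => (h u).imp fun _ => Eq.symm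
      trans := fun {p q r} h h' u => by
        obtain ⟨w, hw⟩ := h u
        obtain ⟨w', hw'⟩ := h' (u ++ w)
        refine ⟨w ++ w', ?_⟩
        rw [← List.append_assoc, ← hw', runWord_append, hw, ← runWord_append] }

lemma StablePair.step {δ : V → A → V} {p q : V} (h : StablePair δ p q) (a : A) :
    StablePair δ (δ p a) (δ q a) := fun u => h (a :: u)

lemma exists_pos_iterate_eq_of_mem_periodicPts [Finite V] (g : V → V) :
    ∃ m, 0 < m ∧ ∀ y ∈ periodicPts g, g^[m] y = y := by
  classical
  have := Fintype.ofFinite V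
  refine ⟨∏ y ∈ Finset.univ.filter (· ∈ periodicPts g), minimalPeriod g y,
    Finset.prod_pos fun y hy => minimalPeriod_pos_of_mem_periodicPts (Finset.mem_filter.1 hy).2,
    fun y hy => ?_⟩
  exact isPeriodicPt_iff_minimalPeriod_dvd.2
    (Finset.dvd_prod_of_mem _ (Finset.mem_filter.2 ⟨Finset.mem_univ _, hy⟩))

/-- The image of the set of all states under a word. -/
def wordImage (δ : V → A → V) (w : List A) : Set V := Set.range fun q => runWord δ q w

lemma wordImage_append (δ : V → A → V) (w w' : List A) :
    wordImage δ (w ++ w') = (fun q => runWord δ q w') '' wordImage δ w := by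
  simp only [wordImage, ← Set.range_comp, comp_def, runWord_append]

/-- A word of minimal rank. -/
def IsMinRank (δ : V → A → V) (w : List A) : Prop :=
  ∀ w', (wordImage δ w).ncard ≤ (wordImage δ w').ncard

lemma exists_isMinRank (δ : V → A → V) : ∃ w, IsMinRank δ w := by
  obtain ⟨w, -, hw⟩ := WellFounded.has_min (measure fun w => (wordImage δ w).ncard).wf Set.univ
    ⟨[], trivial⟩
  exact ⟨w, fun w' => not_lt.1 (hw w' trivial)⟩

lemma IsMinRank.append [Finite V] {δ : V → A → V} {w : List A} (hw : IsMinRank δ w)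
    (w' : List A) : IsMinRank δ (w ++ w') := fun v => by
  rw [wordImage_append]
  exact (Set.ncard_image_le (Set.toFinite _)).trans (hw v)

lemma IsMinRank.injOn [Finite V] {δ : V → A → V} {w : List A} (hw : IsMinRank δ w)
    (w' : List A) : (wordImage δ w).InjOn fun q => runWord δ q w' := by
  refine Set.injOn_of_ncard_image_eq ?_ (Set.toFinite _)
  rw [← wordImage_append]
  exact le_antisymm (by
    rw [wordImage_append]
    exact Set.ncard_image_le (Set.toFinite _)) (hw _)

lemma IsMinRank.image_eq [Finite V] {δ : V → A → V} {w : List A} (hw : IsMinRank δ w)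
    (u v : List A) : (fun q => runWord δ q (v ++ w)) '' wordImage δ u = wordImage δ w := by
  refine Set.eq_of_subset_of_ncard_le ?_ ?_ (Set.toFinite _)
  · rintro _ ⟨q, -, rfl⟩
    exact ⟨runWord δ q v, (runWord_append ..).symm⟩
  · rw [← wordImage_append]
    exact hw _

lemma exists_stablePair [Finite V] {δ : V → A → V} {a : A}
    (hsc : ∀ p q, ∃ w, runWord δ p w = q) (ha : DeepPointsMerge fun v => δ v a) :
    ∃ s t, s ≠ t ∧ StablePair δ s t := by
  set g := fun v => δ v a with hg
  obtain ⟨n, ⟨p, hp⟩, hmerge⟩ := ha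
  obtain ⟨m, hm, hper⟩ := exists_pos_iterate_eq_of_mem_periodicPts g
  obtain ⟨w₀, hw₀⟩ := exists_isMinRank δ
  obtain ⟨v, hv⟩ := hsc (runWord δ p w₀) p
  have hw₁ := hw₀.append v
  set w₁ := w₀ ++ v with hw₁def
  have hpI : p ∈ wordImage δ w₁ := ⟨p, by simp only [hw₁def, runWord_append, hv]⟩
  have hothers : ∀ x ∈ wordImage δ w₁, x ≠ p → g^[n] x ∈ periodicPts g := by
    intro x hx hxp
    by_contra hn
    obtain ⟨j, hj⟩ := hmerge x p hn hp
    refine hxp (hw₁.injOn (List.replicate j a) hx hpI ?_)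
    simpa only [runWord_replicate] using hj
  refine ⟨g^[n] p, g^[m] (g^[n] p), fun h => hp (mk_mem_periodicPts hm h.symm), fun u => ⟨w₀, ?_⟩⟩
  set F := fun q => runWord δ q (List.replicate n a ++ u ++ w₀) with hF
  set G := fun q => runWord δ q (List.replicate n a ++ List.replicate m a ++ u ++ w₀) with hG
  have hFG : ∀ x ∈ wordImage δ w₁, x ≠ p → F x = G x := by
    intro x hx hxp
    simp only [hF, hG, runWord_append, runWord_replicate]
    rw [← hg, hper _ (hothers x hx hxp)]
  have hmem : F p ∈ G '' wordImage δ w₁ := by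
    rw [hw₀.image_eq, ← hw₀.image_eq w₁ (List.replicate n a ++ u)]
    exact ⟨p, hpI, rfl⟩
  obtain ⟨y, hy, hyp⟩ := hmem
  obtain rfl : y = p := by
    by_contra hne
    exact hne (hw₁.injOn _ hy hpI ((hFG y hy hne).trans hyp))
  simpa only [hF, hG, runWord_append, runWord_replicate] using hyp.symm

/-- The automaton obtained from the labelled digraph `f` by permuting the labels at each vertex. -/
def recolor (f : V → A → V) (π : V → Equiv.Perm A) (v : V) (c : A) : V := f v (π v c)

lemma exists_runWord_recolor (f : V → A → V) (π : V → Equiv.Perm A) (p : V) (w : List A) :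
    ∃ w', w'.length = w.length ∧ runWord (recolor f π) p w' = runWord f p w := by
  induction w generalizing p with
  | nil => exact ⟨[], rfl, rfl⟩
  | cons a w ih =>
    obtain ⟨w', hl, hw'⟩ := ih (f p a)
    refine ⟨(π p).symm a :: w', by simp [hl], ?_⟩
    change runWord _ (recolor f π p _) w' = runWord f (f p a) w
    rw [← hw', recolor, Equiv.apply_symm_apply]

lemma exists_runWord_eq_recolor (f : V → A → V) (π : V → Equiv.Perm A) (p : V) (w : List A) :
    ∃ w', w'.length = w.length ∧ runWord f p w' = runWord (recolor f π) p w := by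
  induction w generalizing p with
  | nil => exact ⟨[], rfl, rfl⟩
  | cons a w ih =>
    obtain ⟨w', hl, hw'⟩ := ih (recolor f π p a)
    exact ⟨π p a :: w', by simp [hl], hw'⟩

/-- Some vertex is reached from both `p` and `q` by walks of the same length. -/
def EqualLengthMeet (f : V → A → V) (p q : V) : Prop :=
  ∃ w w', w.length = w'.length ∧ runWord f p w = runWord f q w'

lemma runWord_semiconj {W : Type*} {δ : V → A → V} {δ' : W → A → W} {φ : V → W}
    (h : ∀ v a, φ (δ v a) = δ' (φ v) a) (p : V) (w : List A) :
    φ (runWord δ p w) = runWord δ' (φ p) w := by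
  induction w generalizing p with
  | nil => rfl
  | cons a w ih => exact (ih _).trans (by rw [h]; rfl)

lemma exists_stablePair_recolor [Finite V] [Nonempty A] {f : V → A → V}
    (hsc : ∀ p q, ∃ w, runWord f p w = q) {s t : V} {i j : A} (hst : s ≠ t)
    (hmeet : f s i = f t j) :
    ∃ π : V → Equiv.Perm A, ∃ s t, s ≠ t ∧ StablePair (recolor f π) s t := by
  classical
  obtain ⟨a⟩ := ‹Nonempty A›
  by_cases hbunch : ∃ s t r, s ≠ t ∧ (∀ i, f s i = r) ∧ ∀ i, f t i = r
  · obtain ⟨s, t, r, hne, hs, ht⟩ := hbunch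
    refine ⟨fun _ => 1, s, t, hne, fun u => ?_⟩
    cases u with
    | nil => exact ⟨[a], (hs a).trans (ht a).symm⟩
    | cons b u =>
      refine ⟨[], ?_⟩
      change runWord _ (f s b) _ = runWord _ (f t b) _
      rw [hs, ht]
  push Not at hbunch
  obtain ⟨g, hg, hdeep⟩ := exists_selector_deepPointsMerge (R := fun x y => ∃ i, f x i = y)
    (fun u v => reflTransGen_iff_exists_runWord.2 (hsc u v)) (fun v => ⟨f v a, a, rfl⟩)
    (fun s t r hne _ _ => by
      by_cases h : ∀ i, f s i = r
      · obtain ⟨i, hi⟩ := hbunch s t r hne h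
        exact Or.inr ⟨_, ⟨i, rfl⟩, hi⟩
      · push Not at h
        obtain ⟨i, hi⟩ := h
        exact Or.inl ⟨_, ⟨i, rfl⟩, hi⟩)
    ⟨s, t, f s i, hst, ⟨i, rfl⟩, ⟨j, hmeet.symm⟩⟩
  choose e he using hg
  have hred : (fun v => recolor f (fun v => Equiv.swap a (e v)) v a) = g := by
    funext v
    rw [recolor, Equiv.swap_apply_left, he]
  refine ⟨fun v => Equiv.swap a (e v), exists_stablePair (a := a) (fun p q => ?_) (hred ▸ hdeep)⟩
  obtain ⟨w, rfl⟩ := hsc p q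
  obtain ⟨w', -, hw'⟩ := exists_runWord_recolor f _ p w
  exact ⟨w', hw'⟩

/-- Every strongly connected digraph of constant outdegree has a coloring which merges all pairs
of vertices that can be merged by walks of equal length. -/
theorem exists_recolor_merging [Nonempty A] (n : ℕ) :
    ∀ (V : Type u) [Finite V] (f : V → A → V), Nat.card V = n →
      (∀ p q, ∃ w, runWord f p w = q) → ∃ π : V → Equiv.Perm A, ∀ p q, EqualLengthMeet f p q →
        ∃ w, runWord (recolor f π) p w = runWord (recolor f π) q w := by
  induction n using Nat.strong_induction_on with
  | _ n ih =>
  intro V _ f hcard hsc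
  by_cases hmeet : ∃ s t i j, s ≠ t ∧ f s i = f t j
  swap
  · push Not at hmeet
    refine ⟨fun _ => 1, fun p q => ?_⟩
    rintro ⟨w, w', hl, hw⟩
    refine ⟨[], ?_⟩
    change p = q
    induction w generalizing p q w' with
    | nil =>
      obtain rfl : w' = [] := List.length_eq_zero_iff.1 hl.symm
      exact hw
    | cons a w ihw =>
      cases w' with
      | nil => simp at hl
      | cons b w' =>
        by_contra hne
        exact hmeet p q a b hne (ihw _ _ w' (by simpa using hl) hw)
  obtain ⟨s, t, i, j, hst, hij⟩ := hmeet
  obtain ⟨π₀, s, t, hst, hstable⟩ := exists_stablePair_recolor hsc hst hij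
  set δ₀ := recolor f π₀ with hδ₀
  let S := stableSetoid δ₀
  let f' : Quotient S → A → Quotient S := fun x a =>
    Quotient.map (fun v => δ₀ v a) (fun _ _ h => StablePair.step h a) x
  have hf' : ∀ v a, (⟦δ₀ v a⟧ : Quotient S) = f' ⟦v⟧ a := fun _ _ => rfl
  have hlt : Nat.card (Quotient S) < n := by
    rw [← hcard]
    refine (Nat.card_le_card_of_surjective _ (Quotient.mk_surjective (s := S))).lt_of_ne fun h => ?_
    have hbij := (Nat.bijective_iff_surjective_and_card (Quotient.mk S)).2
      ⟨Quotient.mk_surjective, h.symm⟩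
    exact hst (hbij.1 (Quotient.sound hstable))
  have hwalk : ∀ p w, ∃ w', w'.length = w.length ∧
      runWord f' ⟦p⟧ w' = (⟦runWord f p w⟧ : Quotient S) := by
    intro p w
    obtain ⟨w', hl, hw'⟩ := exists_runWord_recolor f π₀ p w
    exact ⟨w', hl, by rw [← hw', runWord_semiconj hf']⟩
  obtain ⟨π', hπ'⟩ := ih _ hlt (Quotient S) f' rfl (by
    intro x y
    induction x using Quotient.inductionOn with | _ p
    induction y using Quotient.inductionOn with | _ q
    obtain ⟨w, rfl⟩ := hsc p q
    obtain ⟨w', -, hw'⟩ := hwalk p w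
    exact ⟨w', hw'⟩)
  let π : V → Equiv.Perm A := fun v => (π' ⟦v⟧).trans (π₀ v)
  have hδ : ∀ v a, recolor f π v a = δ₀ v (π' ⟦v⟧ a) := fun _ _ => rfl
  have htransfer : ∀ u x y, (⟦x⟧ : Quotient S) = ⟦y⟧ → ∃ w,
      runWord (recolor f π) x w = runWord δ₀ x u ∧
        runWord (recolor f π) y w = runWord δ₀ y u := by
    intro u
    induction u with
    | nil => exact fun x y _ => ⟨[], rfl, rfl⟩
    | cons c u ihu =>
      intro x y hxy
      obtain ⟨w, hx, hy⟩ := ihu (δ₀ x c) (δ₀ y c) (by rw [hf', hf', hxy])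
      refine ⟨(π' ⟦x⟧).symm c :: w, ?_, ?_⟩
      · change runWord _ (recolor f π x _) w = runWord δ₀ (δ₀ x c) u
        rw [hδ, Equiv.apply_symm_apply, hx]
      · change runWord _ (recolor f π y _) w = runWord δ₀ (δ₀ y c) u
        rw [hδ, ← hxy, Equiv.apply_symm_apply, hy]
  refine ⟨π, fun p q => ?_⟩
  rintro ⟨w, w', hl, hw⟩
  obtain ⟨v, hvl, hv⟩ := hwalk p w
  obtain ⟨v', hvl', hv'⟩ := hwalk q w'
  obtain ⟨z, hz⟩ := hπ' ⟦p⟧ ⟦q⟧ ⟨v, v', by omega, by rw [hv, hv', hw]⟩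
  have hsemi : ∀ v a, (⟦recolor f π v a⟧ : Quotient S) = recolor f' π' ⟦v⟧ a := fun _ _ => rfl
  have hz' : (⟦runWord (recolor f π) p z⟧ : Quotient S) = ⟦runWord (recolor f π) q z⟧ := by
    rw [runWord_semiconj hsemi, hz, ← runWord_semiconj hsemi]
  obtain ⟨u, hu⟩ := (Quotient.exact hz' : StablePair δ₀ _ _) []
  obtain ⟨y, hy, hy'⟩ := htransfer u _ _ hz'
  exact ⟨z ++ y, by rw [runWord_append, runWord_append, hy, hy']; exact hu⟩

lemma isClosedWalk_of_runWord {f : V → A → V} {v : V} {w : List A} (hw : w ≠ [])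
    (h : runWord f v w = v) : IsClosedWalk (fun x y => ∃ i, f x i = y) v w.length := by
  refine ⟨List.length_pos_iff.2 hw, fun i => runWord f v (w.take i), rfl, by simpa using h,
    fun i hi => ⟨w[i], ?_⟩⟩
  change _ = runWord f v (w.take (i + 1))
  rw [List.take_succ_eq_append_getElem hi, runWord_append]
  rfl

lemma IsClosedWalk.exists_runWord {f : V → A → V} {v : V} {n : ℕ}
    (h : IsClosedWalk (fun x y => ∃ i, f x i = y) v n) :
    ∃ w : List A, w.length = n ∧ runWord f v w = v := by
  obtain ⟨-, g, h0, hn, hg⟩ := h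
  have key : ∀ m ≤ n, ∃ w : List A, w.length = m ∧ runWord f v w = g m := by
    intro m
    induction m with
    | zero => exact fun _ => ⟨[], rfl, h0.symm⟩
    | succ m ih =>
      intro hm
      obtain ⟨w, hl, hw⟩ := ih (by omega)
      obtain ⟨i, hi⟩ := hg m hm
      exact ⟨w ++ [i], by simp [hl], by rw [runWord_append, hw]; exact hi⟩
  obtain ⟨w, hl, hw⟩ := key n le_rfl
  exact ⟨w, hl, hw.trans hn⟩

/-- If `k` is the gcd of the lengths of all closed walks, then at each vertex all large multiples
of `k` are lengths of closed walks. -/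
lemma exists_runWord_self_of_dvd {f : V → A → V} {k : ℕ}
    (hsc : ∀ p q, ∃ w, runWord f p w = q)
    (hk : ∀ m : ℕ, (∀ v n, IsClosedWalk (fun x y => ∃ i, f x i = y) v n → m ∣ n) → m ∣ k)
    (v : V) : ∃ N, ∀ m ≥ N, k ∣ m → ∃ w, w.length = m ∧ runWord f v w = v := by
  let s : AddSubmonoid ℕ :=
    { carrier := {n | ∃ w, w.length = n ∧ runWord f v w = v}
      zero_mem' := ⟨[], rfl, rfl⟩
      add_mem' := by
        rintro _ _ ⟨w, rfl, hw⟩ ⟨w', rfl, hw'⟩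
        exact ⟨w ++ w', by simp, by rw [runWord_append, hw, hw']⟩ }
  obtain ⟨N, hN⟩ := Nat.exists_mem_closure_of_ge (s : Set ℕ)
  refine ⟨N, fun m hm hkm => ?_⟩
  have hdvd : Nat.setGcd (s : Set ℕ) ∣ k := hk _ fun u n hu => by
    obtain ⟨z, rfl, hz⟩ := hu.exists_runWord
    obtain ⟨x, hx⟩ := hsc v u
    obtain ⟨y, hy⟩ := hsc u v
    have h1 : (x ++ y).length ∈ (s : Set ℕ) := ⟨_, rfl, by rw [runWord_append, hx, hy]⟩
    have h2 : (x ++ z ++ y).length ∈ (s : Set ℕ) :=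
      ⟨_, rfl, by rw [runWord_append, runWord_append, hx, hz, hy]⟩
    refine (Nat.dvd_add_right (Nat.setGcd_dvd_of_mem h1)).1 ?_
    convert Nat.setGcd_dvd_of_mem h2 using 1
    simp only [List.length_append]
    omega
  have := hN m hm (hdvd.trans hkm)
  rwa [AddSubmonoid.closure_eq] at this

lemma equalLengthMeet_of_modEq {f : V → A → V} {k : ℕ}
    (hsc : ∀ p q, ∃ w, runWord f p w = q)
    (hk : ∀ m : ℕ, (∀ v n, IsClosedWalk (fun x y => ∃ i, f x i = y) v n → m ∣ n) → m ∣ k)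
    {p q r : V} {w w' : List A} (hp : runWord f p w = r) (hq : runWord f q w' = r)
    (hmod : w.length ≡ w'.length [MOD k]) : EqualLengthMeet f p q := by
  wlog hle : w.length ≤ w'.length generalizing p q w w'
  · obtain ⟨x, y, hl, h⟩ := this hq hp hmod.symm (by omega)
    exact ⟨y, x, hl.symm, h.symm⟩
  obtain ⟨N, hN⟩ := exists_runWord_self_of_dvd hsc hk r
  have hd : k ∣ w'.length - w.length := (Nat.modEq_iff_dvd' hle).1 hmod
  rcases Nat.eq_zero_or_pos k with rfl | hkpos
  · exact ⟨w, w', by rw [zero_dvd_iff] at hd; omega, hp.trans hq.symm⟩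
  have hNk : N ≤ k * N := Nat.le_mul_of_pos_left _ hkpos
  obtain ⟨x, hxl, hx⟩ := hN (k * N + (w'.length - w.length)) (by omega)
    (Dvd.dvd.add (Dvd.intro _ rfl) hd)
  obtain ⟨y, hyl, hy⟩ := hN (k * N) hNk (Dvd.intro _ rfl)
  exact ⟨w ++ x, w' ++ y, by simp only [List.length_append]; omega,
    by rw [runWord_append, runWord_append, hp, hq, hx, hy]⟩

end Automata

/-- Generalized road coloring: if `k` is the gcd of the cycle lengths of a finite
strongly connected digraph of uniform outdegree, then some coloring admits a
`k`-synchronizing word, and no coloring admits an `m`-synchronizing word for `m < k`. -/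
theorem k_sync_road_coloring {V : Type*} [Fintype V] [Nonempty V] [DecidableEq V]
    {d : ℕ} (hd : 0 < d) (f : V → Fin d → V) (k : ℕ)
    (hsc : ∀ u v : V, Relation.ReflTransGen (fun x y => ∃ i, f x i = y) u v)
    (hk1 : ∀ v n, IsClosedWalk (fun x y => ∃ i, f x i = y) v n → k ∣ n)
    (hk2 : ∀ m : ℕ, (∀ v n, IsClosedWalk (fun x y => ∃ i, f x i = y) v n → m ∣ n) → m ∣ k) :
    (∃ π : V → Equiv.Perm (Fin d), ∃ w : List (Fin d),
        (Finset.univ.image fun q => runWord (fun v c => f v (π v c)) q w).card ≤ k) ∧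
      ∀ π : V → Equiv.Perm (Fin d), ∀ w : List (Fin d),
        k ≤ (Finset.univ.image fun q => runWord (fun v c => f v (π v c)) q w).card := by
  classical
  have : Nonempty (Fin d) := ⟨⟨0, hd⟩⟩
  have hreach : ∀ p q, ∃ w, runWord f p w = q :=
    fun p q => reflTransGen_iff_exists_runWord.1 (hsc p q)
  have hclosed : ∀ (π : V → Equiv.Perm (Fin d)) (v : V) (w : List (Fin d)),
      runWord (recolor f π) v w = v → k ∣ w.length := by
    intro π v w hw
    obtain ⟨w', hl, hw'⟩ := exists_runWord_eq_recolor f π v w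
    rw [← hl]
    by_cases h : w' = []
    · simp [h]
    · exact hk1 _ _ (isClosedWalk_of_runWord h (hw'.trans hw))
  have v₀ : V := Classical.arbitrary V
  constructor
  · have hk : 0 < k := by
      rw [Nat.pos_iff_ne_zero]
      rintro rfl
      obtain ⟨w, hw⟩ := hreach (f v₀ ⟨0, hd⟩) v₀
      have := hk1 v₀ _ (isClosedWalk_of_runWord (f := f) (w := ⟨0, hd⟩ :: w) (List.cons_ne_nil _ _) hw)
      simp at this
    obtain ⟨π, hπ⟩ := exists_recolor_merging _ V f rfl hreach
    obtain ⟨w, hw⟩ := exists_isMinRank (recolor f π)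
    refine ⟨π, w, ?_⟩
    choose z hz using fun p => hreach p v₀
    rw [← Finset.card_range k]
    refine Finset.card_le_card_of_injOn (fun x => (z x).length % k)
      (fun x _ => by simpa using Nat.mod_lt _ hk) fun x hx y hy hxy => ?_
    obtain ⟨v, hv⟩ := hπ x y (equalLengthMeet_of_modEq hreach hk2 (hz x) (hz y) hxy)
    simp only [Finset.coe_image, Finset.coe_univ, Set.image_univ] at hx hy
    exact hw.injOn v hx hy hv
  · intro π w
    change k ≤ (Finset.univ.image fun q => runWord (recolor f π) q w).card
    have hreach' : ∀ p q, ∃ w, runWord (recolor f π) p w = q := fun p q => by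
      obtain ⟨w, rfl⟩ := hreach p q
      obtain ⟨w', -, hw'⟩ := exists_runWord_recolor f π p w
      exact ⟨w', hw'⟩
    conv_lhs => rw [← Finset.card_range k]
    refine Finset.card_le_card_of_injOn
      (fun i => runWord (recolor f π) v₀ (List.replicate i ⟨0, hd⟩ ++ w)) (fun i _ => ?_)
      fun i hi j hj hij => ?_
    · simp only [Finset.coe_image, Finset.coe_univ, Set.image_univ, runWord_append]
      exact ⟨_, rfl⟩
    · simp only [Finset.coe_range, Set.mem_Iio] at hi hj hij
      obtain ⟨y, hy⟩ := hreach'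
        (runWord (recolor f π) v₀ (List.replicate i ⟨0, hd⟩ ++ w)) v₀
      have h1 := hclosed π v₀ (List.replicate i ⟨0, hd⟩ ++ w ++ y) ((runWord_append ..).trans hy)
      have h2 := hclosed π v₀ (List.replicate j ⟨0, hd⟩ ++ w ++ y)
        (by rwa [runWord_append, ← hij])
      simp only [List.length_append, List.length_replicate] at h1 h2
      have h3 : i ≡ j [MOD k] := by
        have := (Nat.modEq_zero_iff_dvd.2 h1).trans (Nat.modEq_zero_iff_dvd.2 h2).symm
        exact Nat.ModEq.add_right_cancel' (w.length + y.length)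
          (by simpa only [add_assoc] using this)
      exact h3.eq_of_lt_of_lt hi hj
end
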